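/- arXiv:1511.05433 — 17 statements merged into one kernel-verified Lean document; each statement's English description precedes it below -/
import Mathlib

section
/- Let Θ ⊆ ℝ be an open convex set, b : ℝ → ℝ strictly convex on Θ, X₀ ∈ ℝ^{N×P₀}, X ∈ ℝ^{N×P}, y ∈ ℝ^N and 0 ≤ λ < ∞. If (β₀⁽¹⁾, β⁽¹⁾) and (β₀⁽²⁾, β⁽²⁾) both minimize the lasso GLM objective −ℓ(β₀, β; y) + λ‖β‖₁ over F = {(β₀, β) ∈ ℝ^{P₀+P} : X₀β₀ + Xβ ∈ Θ^N}, then X₀β₀⁽¹⁾ + Xβ⁽¹⁾ = X₀β₀⁽²⁾ + Xβ⁽²⁾, i.e., the fitted linear predictor of the lasso GLM is unique. -/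
open Matrix

/-- Negative log-likelihood plus lasso penalty for the canonical GLM:
`-ℓ(β₀, β; y) + λ‖β‖₁` where `ℓ(β₀, β; y) = ∑ₙ [yₙ θₙ - b(θₙ)]`,
`θ = X₀ β₀ + X β`. -/
noncomputable def glmLassoObj {N P₀ P : ℕ} (b : ℝ → ℝ)
    (X₀ : Matrix (Fin N) (Fin P₀) ℝ) (X : Matrix (Fin N) (Fin P) ℝ)
    (y : Fin N → ℝ) (lam : ℝ) (β₀ : Fin P₀ → ℝ) (β : Fin P → ℝ) : ℝ :=
  -(∑ n, (y n * (X₀.mulVec β₀ + X.mulVec β) n - b ((X₀.mulVec β₀ + X.mulVec β) n)))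
    + lam * ∑ p, |β p|

/-- The feasible set `F = {(β₀, β) : X₀β₀ + Xβ ∈ Θ^N}`. -/
def glmFeasible {N P₀ P : ℕ} (Θ : Set ℝ)
    (X₀ : Matrix (Fin N) (Fin P₀) ℝ) (X : Matrix (Fin N) (Fin P) ℝ)
    (β₀ : Fin P₀ → ℝ) (β : Fin P → ℝ) : Prop :=
  ∀ n, (X₀.mulVec β₀ + X.mulVec β) n ∈ Θ

/-- The fitted linear predictor `X₀β̂₀ + Xβ̂` of the lasso GLM is unique. -/
theorem glm_lasso_unique_fit {N P₀ P : ℕ}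
    (Θ : Set ℝ) (hΘopen : IsOpen Θ) (hΘconv : Convex ℝ Θ)
    (b : ℝ → ℝ) (hb : StrictConvexOn ℝ Θ b)
    (X₀ : Matrix (Fin N) (Fin P₀) ℝ) (X : Matrix (Fin N) (Fin P) ℝ)
    (y : Fin N → ℝ) (lam : ℝ) (hlam : 0 ≤ lam)
    (β₀1 β₀2 : Fin P₀ → ℝ) (β1 β2 : Fin P → ℝ)
    (hfeas1 : glmFeasible Θ X₀ X β₀1 β1)
    (hfeas2 : glmFeasible Θ X₀ X β₀2 β2)
    (hmin1 : ∀ γ₀ γ, glmFeasible Θ X₀ X γ₀ γ →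
      glmLassoObj b X₀ X y lam β₀1 β1 ≤ glmLassoObj b X₀ X y lam γ₀ γ)
    (hmin2 : ∀ γ₀ γ, glmFeasible Θ X₀ X γ₀ γ →
      glmLassoObj b X₀ X y lam β₀2 β2 ≤ glmLassoObj b X₀ X y lam γ₀ γ) :
    X₀.mulVec β₀1 + X.mulVec β1 = X₀.mulVec β₀2 + X.mulVec β2 := by
  by_contra hne
  obtain ⟨k, hk⟩ := Function.ne_iff.mp hne
  have hmid : X₀.mulVec ((1/2 : ℝ) • β₀1 + (1/2 : ℝ) • β₀2)
      + X.mulVec ((1/2 : ℝ) • β1 + (1/2 : ℝ) • β2)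
      = (1/2 : ℝ) • (X₀.mulVec β₀1 + X.mulVec β1)
        + (1/2 : ℝ) • (X₀.mulVec β₀2 + X.mulVec β2) := by
    simp only [Matrix.mulVec_add, Matrix.mulVec_smul, smul_add]
    abel
  have hf : glmFeasible Θ X₀ X ((1/2 : ℝ) • β₀1 + (1/2 : ℝ) • β₀2)
      ((1/2 : ℝ) • β1 + (1/2 : ℝ) • β2) := by
    intro n
    rw [hmid]
    exact hΘconv (hfeas1 n) (hfeas2 n) (by norm_num) (by norm_num) (by norm_num)
  have h1 := hmin1 _ _ hf
  have h2 := hmin2 _ _ hf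
  unfold glmFeasible at hfeas1 hfeas2
  unfold glmLassoObj at h1 h2
  rw [hmid] at h1 h2
  generalize X₀.mulVec β₀1 + X.mulVec β1 = u at *
  generalize X₀.mulVec β₀2 + X.mulVec β2 = v at *
  have hB : ∑ n, b (((1/2 : ℝ) • u + (1/2 : ℝ) • v) n)
      < ∑ n, ((1/2 : ℝ) * b (u n) + (1/2 : ℝ) * b (v n)) := by
    apply Finset.sum_lt_sum
    · intro n _
      exact hb.convexOn.2 (hfeas1 n) (hfeas2 n) (by norm_num) (by norm_num) (by norm_num)
    · exact ⟨k, Finset.mem_univ k,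
        hb.2 (hfeas1 k) (hfeas2 k) hk (by norm_num) (by norm_num) (by norm_num)⟩
  have hY : ∑ n, y n * ((1/2 : ℝ) • u + (1/2 : ℝ) • v) n
      = (1/2 : ℝ) * ∑ n, y n * u n + (1/2 : ℝ) * ∑ n, y n * v n := by
    rw [Finset.mul_sum, Finset.mul_sum, ← Finset.sum_add_distrib]
    refine Finset.sum_congr rfl fun n _ => ?_
    simp only [Pi.add_apply, Pi.smul_apply, smul_eq_mul]
    ring
  have hA : ∑ p, |((1/2 : ℝ) • β1 + (1/2 : ℝ) • β2) p|
      ≤ (1/2 : ℝ) * ∑ p, |β1 p| + (1/2 : ℝ) * ∑ p, |β2 p| := by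
    rw [Finset.mul_sum, Finset.mul_sum, ← Finset.sum_add_distrib]
    refine Finset.sum_le_sum fun p _ => ?_
    simp only [Pi.add_apply, Pi.smul_apply, smul_eq_mul]
    refine (abs_add_le _ _).trans (le_of_eq ?_)
    rw [abs_mul, abs_mul, abs_of_pos (by norm_num : (0 : ℝ) < 1/2)]
  have hA2 := mul_le_mul_of_nonneg_left hA hlam
  rw [Finset.sum_add_distrib, ← Finset.mul_sum, ← Finset.mul_sum] at hB
  rw [Finset.sum_sub_distrib, Finset.sum_sub_distrib, hY] at h1 h2
  linarith
end

section
/- Let Θ ⊆ ℝ be an open convex set, b : ℝ → ℝ convex and differentiable on Θ, X₀ ∈ ℝ^{N×P₀}, X ∈ ℝ^{N×P}, y ∈ ℝ^N and 0 ≤ λ < ∞. Define μ(β₀) = (b′(x₀₁ᵀβ₀), …, b′(x₀ₙᵀβ₀))ᵀ. Then (β̂₀, 0) minimizes −ℓ(β₀, β; y) + λ‖β‖₁ over F if and only if the following three conditions hold: (a) X₀β̂₀ ∈ Θ^N, (b) X₀ᵀy = X₀ᵀμ(β̂₀), and (c) ‖Xᵀ[y − μ(β̂₀)]‖_∞ ≤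 λ. -/
open Matrix

theorem tangent_le_aux {Θ : Set ℝ} {b : ℝ → ℝ} (hb : ConvexOn ℝ Θ b) {x z m : ℝ}
    (hx : x ∈ Θ) (hz : z ∈ Θ) (hd : HasDerivAt b m x) : b x + m * (z - x) ≤ b z := by
  rcases lt_trichotomy x z with h | h | h
  · have := hb.le_slope_of_hasDerivAt hx hz h hd
    rw [slope_def_field, le_div_iff₀ (sub_pos.2 h)] at this
    linarith
  · subst h; simp
  · have := hb.slope_le_of_hasDerivAt hz hx h hd
    rw [slope_def_field, div_le_iff₀ (sub_pos.2 h)] at this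
    linarith

theorem deriv_nonneg_aux {g : ℝ → ℝ} {m : ℝ} (hd : HasDerivAt g m 0)
    (h : ∀ᶠ t in nhdsWithin (0:ℝ) (Set.Ioi 0), g 0 ≤ g t) : 0 ≤ m := by
  have h1 := hd.tendsto_slope_zero_right
  refine ge_of_tendsto h1 ?_
  filter_upwards [h, self_mem_nhdsWithin] with t ht ht0
  have ht0' : (0:ℝ) < t := ht0
  simp only [zero_add, smul_eq_mul]
  exact mul_nonneg (inv_nonneg.2 ht0'.le) (sub_nonneg.2 ht)

theorem sum_split_aux {N P₀ P : ℕ} (X₀ : Matrix (Fin N) (Fin P₀) ℝ)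
    (X : Matrix (Fin N) (Fin P) ℝ) (r : Fin N → ℝ) (d₀ : Fin P₀ → ℝ) (d : Fin P → ℝ) :
    ∑ n, r n * (X₀.mulVec d₀ + X.mulVec d) n
      = (Matrix.vecMul r X₀) ⬝ᵥ d₀ + (Matrix.vecMul r X) ⬝ᵥ d := by
  rw [← Matrix.dotProduct_mulVec, ← Matrix.dotProduct_mulVec, ← dotProduct_add]
  rfl

/-- KKT characterization: `(β̂₀, 0)` minimizes the lasso GLM objective over `F`
iff `X₀β̂₀ ∈ Θ^N`, `X₀ᵀy = X₀ᵀμ(β̂₀)` and `‖Xᵀ[y − μ(β̂₀)]‖_∞ ≤ λ`,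
where `μ(β₀)ₙ = b′(x₀ₙᵀβ₀)`. -/
theorem glm_lasso_kkt {N P₀ P : ℕ}
    (Θ : Set ℝ) (hΘopen : IsOpen Θ) (hΘconv : Convex ℝ Θ)
    (b b' : ℝ → ℝ) (hb : ConvexOn ℝ Θ b)
    (hderiv : ∀ θ ∈ Θ, HasDerivAt b (b' θ) θ)
    (X₀ : Matrix (Fin N) (Fin P₀) ℝ) (X : Matrix (Fin N) (Fin P) ℝ)
    (y : Fin N → ℝ) (lam : ℝ) (hlam : 0 ≤ lam)
    (β₀hat : Fin P₀ → ℝ) :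
    (glmFeasible Θ X₀ X β₀hat 0 ∧
      ∀ γ₀ γ, glmFeasible Θ X₀ X γ₀ γ →
        glmLassoObj b X₀ X y lam β₀hat 0 ≤ glmLassoObj b X₀ X y lam γ₀ γ)
    ↔
    ((∀ n, X₀.mulVec β₀hat n ∈ Θ) ∧
      X₀ᵀ.mulVec y = X₀ᵀ.mulVec (fun n => b' (X₀.mulVec β₀hat n)) ∧
      (⨆ p : Fin P, |∑ n, X n p * (y n - b' (X₀.mulVec β₀hat n))|) ≤ lam) := by
  set θ : Fin N → ℝ := X₀.mulVec β₀hat with hθ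
  set r : Fin N → ℝ := fun n => b' (θ n) - y n with hr
  have hfeas : glmFeasible Θ X₀ X β₀hat 0 ↔ ∀ n, θ n ∈ Θ := by
    simp [glmFeasible, hθ]
  have hB : X₀ᵀ.mulVec y = X₀ᵀ.mulVec (fun n => b' (θ n)) ↔ Matrix.vecMul r X₀ = 0 := by
    have : r = (fun n => b' (θ n)) - y := rfl
    rw [this, Matrix.sub_vecMul, sub_eq_zero, Matrix.mulVec_transpose, Matrix.mulVec_transpose,
      eq_comm]
  have hC : (⨆ p : Fin P, |∑ n, X n p * (y n - b' (θ n))|) ≤ lam ↔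
      ∀ p, |Matrix.vecMul r X p| ≤ lam := by
    have e : ∀ p, |∑ n, X n p * (y n - b' (θ n))| = |Matrix.vecMul r X p| := by
      intro p
      rw [← abs_neg, ← Finset.sum_neg_distrib]
      congr 1
      simp only [Matrix.vecMul, dotProduct, hr]
      exact Finset.sum_congr rfl fun n _ => by ring
    simp only [e]
    constructor
    · intro h p
      exact (le_ciSup (f := fun p => |Matrix.vecMul r X p|) (Set.finite_range _).bddAbove p).trans h
    · intro h
      exact Real.iSup_le h hlam
  rw [hfeas, hB, hC]
  refine and_congr_right fun hmem => ?_
  constructor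
  · intro hmin
    have VI : ∀ d₀ d, 0 ≤ Matrix.vecMul r X₀ ⬝ᵥ d₀ + Matrix.vecMul r X ⬝ᵥ d
        + lam * ∑ p, |d p| := by
      intro d₀ d
      rw [← sum_split_aux]
      set v : Fin N → ℝ := X₀.mulVec d₀ + X.mulVec d with hv
      have hlin : ∀ t : ℝ, X₀.mulVec (β₀hat + t • d₀) + X.mulVec (t • d) = fun n => θ n + t * v n := by
        intro t
        ext n
        simp [Matrix.mulVec_add, Matrix.mulVec_smul, hv, hθ]
        ring
      let g : ℝ → ℝ := fun t =>
        (∑ n, (b (θ n + t * v n) - y n * (θ n + t * v n))) + t * (lam * ∑ p, |d p|)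
      have hg : HasDerivAt g (∑ n, r n * v n + lam * ∑ p, |d p|) 0 := by
        have h1 : ∀ n, HasDerivAt (fun t : ℝ => θ n + t * v n) (v n) 0 := fun n => by
          simpa using ((hasDerivAt_id (0:ℝ)).mul_const (v n)).const_add (θ n)
        have h2 : ∀ n, HasDerivAt (fun t : ℝ => b (θ n + t * v n) - y n * (θ n + t * v n))
            (r n * v n) 0 := fun n => by
          have hb0 : HasDerivAt b (b' (θ n)) (θ n + 0 * v n) := by
            simpa using hderiv _ (hmem n)
          have := (HasDerivAt.comp (0:ℝ) hb0 (h1 n)).sub ((h1 n).const_mul (y n))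
          have e : r n * v n = b' (θ n) * v n - y n * v n := sub_mul (b' (θ n)) (y n) (v n)
          rw [e]
          exact this
        have h3 := HasDerivAt.fun_sum (u := Finset.univ) fun n _ => h2 n
        have h4 := (hasDerivAt_id (0:ℝ)).mul_const (lam * ∑ p, |d p|)
        rw [one_mul] at h4
        exact h3.add h4
      refine deriv_nonneg_aux hg ?_
      have hev : ∀ᶠ t in nhdsWithin (0:ℝ) (Set.Ioi 0), ∀ n, θ n + t * v n ∈ Θ := by
        refine Filter.Eventually.filter_mono nhdsWithin_le_nhds ?_
        rw [Filter.eventually_all]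
        intro n
        have hc : ContinuousAt (fun t : ℝ => θ n + t * v n) 0 := by fun_prop
        exact hc.eventually_mem (hΘopen.mem_nhds (by simpa using hmem n))
      filter_upwards [hev, self_mem_nhdsWithin] with t ht ht0
      have ht0' : (0:ℝ) < t := ht0
      have key := hmin (β₀hat + t • d₀) (t • d) (by
        intro n; rw [hlin]; exact ht n)
      unfold glmLassoObj at key
      rw [hlin] at key
      have habs : ∑ p, |(t • d) p| = t * ∑ p, |d p| := by
        rw [Finset.mul_sum]
        exact Finset.sum_congr rfl fun p _ => by simp [abs_mul, abs_of_pos ht0']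
      rw [habs] at key
      simp only [g]
      simp only [Matrix.mulVec_zero, add_zero, Pi.zero_apply, abs_zero, Finset.sum_const_zero,
        mul_zero, Finset.sum_sub_distrib, ← hθ] at key
      simp only [zero_mul, add_zero, Finset.sum_sub_distrib]
      linarith
    constructor
    · have h := VI (-(Matrix.vecMul r X₀)) 0
      simp only [dotProduct_neg, dotProduct_zero, Pi.zero_apply, abs_zero,
        Finset.sum_const_zero, mul_zero, add_zero] at h
      have h2 : 0 ≤ Matrix.vecMul r X₀ ⬝ᵥ Matrix.vecMul r X₀ :=
        Finset.sum_nonneg fun i _ => mul_self_nonneg _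
      exact dotProduct_self_eq_zero.1 (le_antisymm (by linarith) h2)
    · intro p
      have hs : ∀ c : ℝ, ∑ q, |(Pi.single p c : Fin P → ℝ) q| = |c| := by
        intro c
        rw [Finset.sum_eq_single p]
        · simp
        · intro q _ hq; simp [hq]
        · simp
      have h1 := VI 0 (Pi.single p 1)
      have h2 := VI 0 (Pi.single p (-1))
      rw [hs] at h1 h2
      simp only [dotProduct_zero, dotProduct_single, abs_neg, abs_one] at h1 h2
      rw [abs_le]
      constructor <;> linarith
  · rintro ⟨h0, h1⟩ γ₀ γ hγ
    unfold glmLassoObj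
    have hin : ∀ n, (X₀.mulVec γ₀ + X.mulVec γ) n ∈ Θ := hγ
    set z := X₀.mulVec γ₀ + X.mulVec γ with hz
    have hsum : ∑ n, (b (θ n) + b' (θ n) * (z n - θ n)) ≤ ∑ n, b (z n) :=
      Finset.sum_le_sum fun n _ => tangent_le_aux hb (hmem n) (hin n) (hderiv _ (hmem n))
    have hs1 := sum_split_aux X₀ X r γ₀ γ
    have hs2 := sum_split_aux X₀ X r β₀hat 0
    rw [h0] at hs1 hs2
    simp only [zero_dotProduct, dotProduct_zero, Matrix.mulVec_zero, add_zero, zero_add,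
      ← hθ, ← hz] at hs1 hs2
    have hbd : -(lam * ∑ p, |γ p|) ≤ Matrix.vecMul r X ⬝ᵥ γ := by
      rw [Finset.mul_sum, ← Finset.sum_neg_distrib]
      refine Finset.sum_le_sum fun p _ => ?_
      have := neg_abs_le (Matrix.vecMul r X p * γ p)
      rw [abs_mul] at this
      have := mul_le_mul_of_nonneg_right (h1 p) (abs_nonneg (γ p))
      linarith
    simp only [hr, sub_mul, mul_sub, Finset.sum_sub_distrib, Finset.sum_add_distrib] at hs1 hs2 hsum
    simp only [Matrix.mulVec_zero, add_zero, Pi.zero_apply, abs_zero, Finset.sum_const_zero,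
      mul_zero, Finset.sum_sub_distrib, ← hθ]
    linarith
end

section
/- Let Θ ⊆ ℝ be an open convex set, b : ℝ → ℝ strictly convex and differentiable on Θ, X₀ ∈ ℝ^{N×P₀} and y ∈ ℝ^N. Define μ(v) = (b′(x₀₁ᵀv), …, b′(x₀ₙᵀv))ᵀ for v with X₀v ∈ Θ^N. If v₁, v₂ ∈ ℝ^{P₀} both satisfy X₀v ∈ Θ^N and X₀ᵀy = X₀ᵀμ(v), then X₀v₁ = X₀v₂ (and hence μ(v₁) = μ(v₂)), so the zero-thresholding function λ₀(y) = ‖Xᵀ[y − μ(v)]‖_∞ of lasso GLM does not depend on which solution v is chosen. -/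
open Matrix

/-- If `v₁, v₂` both satisfy `X₀v ∈ Θ^N` and `X₀ᵀy = X₀ᵀμ(v)` where
`μ(v)ₙ = b′(x₀ₙᵀv)` for a strictly convex differentiable `b`, then
`X₀v₁ = X₀v₂` and hence `μ(v₁) = μ(v₂)`: the zero-thresholding function of the
lasso GLM does not depend on which solution `v` is chosen. -/
theorem glm_constrained_mle_fit_unique {N P₀ : ℕ}
    (Θ : Set ℝ) (hΘopen : IsOpen Θ) (hΘconv : Convex ℝ Θ)
    (b b' : ℝ → ℝ) (hb : StrictConvexOn ℝ Θ b)
    (hderiv : ∀ θ ∈ Θ, HasDerivAt b (b' θ) θ)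
    (X₀ : Matrix (Fin N) (Fin P₀) ℝ) (y : Fin N → ℝ)
    (v₁ v₂ : Fin P₀ → ℝ)
    (hv₁Θ : ∀ n, X₀.mulVec v₁ n ∈ Θ)
    (hv₂Θ : ∀ n, X₀.mulVec v₂ n ∈ Θ)
    (hv₁ : X₀ᵀ.mulVec y = X₀ᵀ.mulVec (fun n => b' (X₀.mulVec v₁ n)))
    (hv₂ : X₀ᵀ.mulVec y = X₀ᵀ.mulVec (fun n => b' (X₀.mulVec v₂ n))) :
    X₀.mulVec v₁ = X₀.mulVec v₂ ∧
      (fun n => b' (X₀.mulVec v₁ n)) = (fun n => b' (X₀.mulVec v₂ n)) := by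
  have hmono : StrictMonoOn b' Θ := by
    have h := hb.strictMonoOn_deriv (fun x hx => (hderiv x hx).differentiableAt)
    intro x hx z hz hxz
    have h2 := h hx hz hxz
    rwa [(hderiv x hx).deriv, (hderiv z hz).deriv] at h2
  have key : ∀ a ∈ Θ, ∀ c ∈ Θ, 0 ≤ (b' a - b' c) * (a - c) ∧
      ((b' a - b' c) * (a - c) = 0 → a = c) := by
    intro a ha c hc
    rcases lt_trichotomy a c with h | h | h
    · have h2 := hmono ha hc h
      have h3 := mul_pos_of_neg_of_neg (sub_neg.2 h2) (sub_neg.2 h)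
      exact ⟨h3.le, fun h0 => absurd h0 h3.ne'⟩
    · exact ⟨by simp [h], fun _ => h⟩
    · have h2 := hmono hc ha h
      have h3 := mul_pos (sub_pos.2 h2) (sub_pos.2 h)
      exact ⟨h3.le, fun h0 => absurd h0 h3.ne'⟩
  have hsum : ∑ n, (b' (X₀.mulVec v₁ n) - b' (X₀.mulVec v₂ n)) *
      (X₀.mulVec v₁ n - X₀.mulVec v₂ n) = 0 := by
    have h1 : X₀ᵀ.mulVec ((fun n => b' (X₀.mulVec v₁ n)) - (fun n => b' (X₀.mulVec v₂ n))) = 0 := by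
      rw [Matrix.mulVec_sub, ← hv₁, ← hv₂, sub_self]
    have h2 : ((fun n => b' (X₀.mulVec v₁ n)) - (fun n => b' (X₀.mulVec v₂ n))) ⬝ᵥ
        (X₀.mulVec (v₁ - v₂)) = 0 := by
      rw [Matrix.dotProduct_mulVec, ← Matrix.mulVec_transpose, h1, zero_dotProduct]
    rw [Matrix.mulVec_sub] at h2
    exact h2
  have hX : X₀.mulVec v₁ = X₀.mulVec v₂ := by
    funext n
    have h := (Finset.sum_eq_zero_iff_of_nonneg
      (fun n _ => (key _ (hv₁Θ n) _ (hv₂Θ n)).1)).1 hsum n (Finset.mem_univ n)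
    exact (key _ (hv₁Θ n) _ (hv₂Θ n)).2 h
  exact ⟨hX, by rw [hX]⟩
end

section
/- Let Θ ⊆ ℝ be an open convex set, b : ℝ → ℝ convex and differentiable on Θ, X₀ ∈ ℝ^{N×P₀}, X ∈ ℝ^{N×P}, y ∈ ℝ^N and 0 ≤ λ < ∞. Let {1,…,P} be partitioned into groups G₁, …, G_G and let X_g denote the submatrix of X with columns indexed by G_g. Define μ(β₀) = (b′(x₀₁ᵀβ₀), …, b′(x₀ₙᵀβ₀))ᵀ. Then (β̂₀, 0) minimizes the group lasso GLM objective −ℓ(β₀, β; y) + λ Σ_{g=1}^G ‖β_{G_g}‖₂ over F if and only if X₀β̂₀ ∈ Θ^N, X₀ᵀy = X₀ᵀμ(β̂₀), and max_{g=1,…,G} ‖X_gᵀ[y − μ(β̂₀)]‖₂ ≤ λ. -/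
open Matrix

/-- Negative log-likelihood plus group lasso penalty for the canonical GLM:
`-ℓ(β₀, β; y) + λ ∑_g ‖β_{G_g}‖₂` where `ℓ(β₀, β; y) = ∑ₙ [yₙ θₙ - b(θₙ)]`,
`θ = X₀ β₀ + X β`, and the groups `G_g` are the fibers of `grp : Fin P → Fin G`. -/
noncomputable def glmGroupLassoObj {N P₀ P G : ℕ} (b : ℝ → ℝ)
    (X₀ : Matrix (Fin N) (Fin P₀) ℝ) (X : Matrix (Fin N) (Fin P) ℝ)
    (y : Fin N → ℝ) (lam : ℝ) (grp : Fin P → Fin G)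
    (β₀ : Fin P₀ → ℝ) (β : Fin P → ℝ) : ℝ :=
  -(∑ n, (y n * (X₀.mulVec β₀ + X.mulVec β) n - b ((X₀.mulVec β₀ + X.mulVec β) n)))
    + lam * ∑ g, Real.sqrt (∑ p ∈ Finset.univ.filter (fun p => grp p = g), (β p) ^ 2)

theorem aux_deriv_nonneg (f : ℝ → ℝ) (f' : ℝ) (h : HasDerivAt f f' 0)
    (hm : ∀ᶠ t in nhdsWithin (0:ℝ) (Set.Ioi 0), f 0 ≤ f t) : 0 ≤ f' := by
  have h1 := (hasDerivAt_iff_tendsto_slope.1 h).mono_left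
    (nhdsWithin_mono (0:ℝ) (fun t (ht : t ∈ Set.Ioi (0:ℝ)) => (ne_of_gt ht : t ≠ 0)))
  refine ge_of_tendsto h1 ?_
  filter_upwards [hm, self_mem_nhdsWithin] with t ht ht0
  have ht0' : (0:ℝ) < t := ht0
  rw [slope_def_field]
  exact div_nonneg (by linarith) (by linarith)

theorem aux_tangent (Θ : Set ℝ) (b b' : ℝ → ℝ) (hb : ConvexOn ℝ Θ b)
    (hderiv : ∀ θ ∈ Θ, HasDerivAt b (b' θ) θ) (s t : ℝ) (hs : s ∈ Θ) (ht : t ∈ Θ) :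
    b s + b' s * (t - s) ≤ b t := by
  rcases lt_trichotomy s t with h | h | h
  · have := hb.le_slope_of_hasDerivAt hs ht h (hderiv s hs)
    rw [slope_def_field, le_div_iff₀ (by linarith)] at this
    linarith
  · subst h; simp
  · have := hb.slope_le_of_hasDerivAt ht hs h (hderiv s hs)
    rw [slope_def_field, div_le_iff₀ (by linarith)] at this
    linarith

theorem aux_dir {N P₀ P G : ℕ}
    (Θ : Set ℝ) (hΘopen : IsOpen Θ)
    (b b' : ℝ → ℝ)
    (hderiv : ∀ θ ∈ Θ, HasDerivAt b (b' θ) θ)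
    (X₀ : Matrix (Fin N) (Fin P₀) ℝ) (X : Matrix (Fin N) (Fin P) ℝ)
    (y : Fin N → ℝ) (lam : ℝ)
    (grp : Fin P → Fin G)
    (β₀hat : Fin P₀ → ℝ) (hf : ∀ n, X₀.mulVec β₀hat n ∈ Θ)
    (hmin : ∀ γ₀ γ, glmFeasible Θ X₀ X γ₀ γ →
        glmGroupLassoObj b X₀ X y lam grp β₀hat 0 ≤ glmGroupLassoObj b X₀ X y lam grp γ₀ γ)
    (d₀ : Fin P₀ → ℝ) (d : Fin P → ℝ) :
    ∑ n, (y n - b' (X₀.mulVec β₀hat n)) * (X₀.mulVec d₀ n + X.mulVec d n) ≤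
      lam * ∑ g, Real.sqrt (∑ p ∈ Finset.univ.filter (fun p => grp p = g), (d p) ^ 2) := by
  set K := ∑ g, Real.sqrt (∑ p ∈ Finset.univ.filter (fun p => grp p = g), (d p) ^ 2) with hK
  set s := X₀.mulVec β₀hat with hs
  set e : Fin N → ℝ := fun n => X₀.mulVec d₀ n + X.mulVec d n with he
  let f : ℝ → ℝ := fun t => -(∑ n, (y n * (s n + t * e n) - b (s n + t * e n))) + lam * (t * K)
  have hline : ∀ n, HasDerivAt (fun t : ℝ => s n + t * e n) (e n) 0 := fun n => by
    simpa using ((hasDerivAt_id (0:ℝ)).mul_const (e n)).const_add (s n)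
  have hfd : HasDerivAt f (-(∑ n, (y n * e n - b' (s n) * e n)) + lam * K) 0 := by
    refine HasDerivAt.add (HasDerivAt.neg (HasDerivAt.fun_sum fun n _ => ?_)) ?_
    · refine ((hline n).const_mul (y n)).sub ?_
      have h2 : HasDerivAt b (b' (s n)) (s n + 0 * e n) := by simpa using hderiv _ (hf n)
      exact h2.comp (0:ℝ) (hline n)
    · simpa using ((hasDerivAt_id (0:ℝ)).mul_const K).const_mul lam
  have hpt : ∀ (t : ℝ) n, (X₀.mulVec (β₀hat + t • d₀) + X.mulVec (t • d)) n = s n + t * e n := by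
    intro t n
    simp only [Matrix.mulVec_add, Matrix.mulVec_smul, Pi.add_apply, Pi.smul_apply, smul_eq_mul, he, hs]
    ring
  have hobj0 : glmGroupLassoObj b X₀ X y lam grp β₀hat 0 = f 0 := by
    simp [glmGroupLassoObj, f, hs]
  have hev : ∀ᶠ t in nhdsWithin (0:ℝ) (Set.Ioi 0), f 0 ≤ f t := by
    have hfe : ∀ᶠ t in nhds (0:ℝ), ∀ n, s n + t * e n ∈ Θ := by
      rw [Filter.eventually_all]
      intro n
      apply (hline n).continuousAt.eventually_mem
      simpa using hΘopen.mem_nhds (hf n)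
    filter_upwards [nhdsWithin_le_nhds hfe, self_mem_nhdsWithin] with t ht ht0
    have ht0' : (0:ℝ) < t := ht0
    have := hmin (β₀hat + t • d₀) (t • d) (fun n => by rw [hpt]; exact ht n)
    rw [hobj0] at this
    refine this.trans (le_of_eq ?_)
    unfold glmGroupLassoObj
    simp only [hpt, f]
    congr 2
    rw [hK, Finset.mul_sum]
    refine Finset.sum_congr rfl fun g _ => ?_
    simp only [Pi.smul_apply, smul_eq_mul, mul_pow]
    rw [← Finset.mul_sum, Real.sqrt_mul (sq_nonneg t), Real.sqrt_sq ht0'.le]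
  have := aux_deriv_nonneg f _ hfd hev
  have h3 : ∑ n, (y n - b' (s n)) * e n = ∑ n, (y n * e n - b' (s n) * e n) :=
    Finset.sum_congr rfl fun n _ => by ring
  change ∑ n, (y n - b' (s n)) * e n ≤ _
  linarith

theorem aux_swap {N P : ℕ} (X : Matrix (Fin N) (Fin P) ℝ) (r : Fin N → ℝ) (d : Fin P → ℝ) :
    ∑ n, r n * X.mulVec d n = ∑ p, (∑ n, X n p * r n) * d p := by
  simp only [Matrix.mulVec, dotProduct, Finset.mul_sum, Finset.sum_mul]
  rw [Finset.sum_comm]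
  exact Finset.sum_congr rfl fun _ _ => Finset.sum_congr rfl fun _ _ => by ring

/-- KKT characterization for the group lasso GLM: `(β̂₀, 0)` minimizes the
objective over `F` iff `X₀β̂₀ ∈ Θ^N`, `X₀ᵀy = X₀ᵀμ(β̂₀)` and
`max_g ‖X_gᵀ[y − μ(β̂₀)]‖₂ ≤ λ`, where `μ(β₀)ₙ = b′(x₀ₙᵀβ₀)`. -/
theorem glm_group_lasso_kkt {N P₀ P G : ℕ}
    (Θ : Set ℝ) (hΘopen : IsOpen Θ) (hΘconv : Convex ℝ Θ)
    (b b' : ℝ → ℝ) (hb : ConvexOn ℝ Θ b)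
    (hderiv : ∀ θ ∈ Θ, HasDerivAt b (b' θ) θ)
    (X₀ : Matrix (Fin N) (Fin P₀) ℝ) (X : Matrix (Fin N) (Fin P) ℝ)
    (y : Fin N → ℝ) (lam : ℝ) (hlam : 0 ≤ lam)
    (grp : Fin P → Fin G)
    (β₀hat : Fin P₀ → ℝ) :
    (glmFeasible Θ X₀ X β₀hat 0 ∧
      ∀ γ₀ γ, glmFeasible Θ X₀ X γ₀ γ →
        glmGroupLassoObj b X₀ X y lam grp β₀hat 0 ≤ glmGroupLassoObj b X₀ X y lam grp γ₀ γ)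
    ↔
    ((∀ n, X₀.mulVec β₀hat n ∈ Θ) ∧
      X₀ᵀ.mulVec y = X₀ᵀ.mulVec (fun n => b' (X₀.mulVec β₀hat n)) ∧
      (⨆ g : Fin G, Real.sqrt (∑ p ∈ Finset.univ.filter (fun p => grp p = g),
        (∑ n, X n p * (y n - b' (X₀.mulVec β₀hat n))) ^ 2)) ≤ lam) := by
  have hzero : ∀ n, (X₀.mulVec β₀hat + X.mulVec 0) n = X₀.mulVec β₀hat n := by simp
  have hscore : (X₀ᵀ.mulVec y = X₀ᵀ.mulVec (fun n => b' (X₀.mulVec β₀hat n))) ↔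
      ∀ p, ∑ n, X₀ n p * (y n - b' (X₀.mulVec β₀hat n)) = 0 := by
    rw [funext_iff]
    refine forall_congr' fun p => ?_
    simp only [mul_sub, Finset.sum_sub_distrib, sub_eq_zero]
    rfl
  rw [hscore]
  constructor
  · rintro ⟨hfeas, hmin⟩
    have hf : ∀ n, X₀.mulVec β₀hat n ∈ Θ := fun n => by rw [← hzero n]; exact hfeas n
    have key := aux_dir Θ hΘopen b b' hderiv X₀ X y lam grp β₀hat hf hmin
    refine ⟨hf, ?_, ?_⟩
    · have h := key (fun p => ∑ n, X₀ n p * (y n - b' (X₀.mulVec β₀hat n))) 0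
      simp only [Matrix.mulVec_zero, Pi.zero_apply, add_zero] at h
      rw [aux_swap X₀ (fun n => y n - b' (X₀.mulVec β₀hat n))] at h
      have h0 : ∑ p, (∑ n, X₀ n p * (y n - b' (X₀.mulVec β₀hat n))) *
          (∑ n, X₀ n p * (y n - b' (X₀.mulVec β₀hat n))) = 0 :=
        le_antisymm (by simpa using h) (Finset.sum_nonneg fun _ _ => mul_self_nonneg _)
      rw [Finset.sum_eq_zero_iff_of_nonneg (fun _ _ => mul_self_nonneg _)] at h0
      exact fun p => mul_self_eq_zero.1 (h0 p (Finset.mem_univ p))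
    · refine Real.iSup_le (fun g => ?_) hlam
      set c : Fin P → ℝ := fun p => ∑ n, X n p * (y n - b' (X₀.mulVec β₀hat n)) with hc
      change Real.sqrt (∑ p ∈ Finset.univ.filter (fun p => grp p = g), (c p) ^ 2) ≤ lam
      set S := ∑ p ∈ Finset.univ.filter (fun p => grp p = g), (c p) ^ 2 with hS
      have hS0 : 0 ≤ S := Finset.sum_nonneg fun _ _ => sq_nonneg _
      have h := key 0 (fun p => if grp p = g then c p else 0)
      simp only [Matrix.mulVec_zero, Pi.zero_apply, zero_add] at h
      rw [aux_swap X (fun n => y n - b' (X₀.mulVec β₀hat n))] at h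
      have e1 : ∑ p, (∑ n, X n p * (y n - b' (X₀.mulVec β₀hat n))) *
          (if grp p = g then c p else 0) = S := by
        rw [hS, Finset.sum_filter]
        refine Finset.sum_congr rfl fun p _ => ?_
        split_ifs
        · simp only [hc]; ring
        · simp
      have e2 : ∑ g', Real.sqrt (∑ p ∈ Finset.univ.filter (fun p => grp p = g'),
          (if grp p = g then c p else 0) ^ 2) = Real.sqrt S := by
        rw [Finset.sum_eq_single g]
        · congr 1
          refine Finset.sum_congr rfl fun p hp => ?_
          rw [if_pos (Finset.mem_filter.1 hp).2]
        · intro g' _ hne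
          rw [Finset.sum_eq_zero, Real.sqrt_zero]
          intro p hp
          rw [if_neg]
          · simp
          · rw [(Finset.mem_filter.1 hp).2]; exact hne
        · simp
      rw [e1, e2] at h
      by_contra hlt
      push Not at hlt
      have := Real.mul_self_sqrt hS0
      nlinarith
  · rintro ⟨hf, h0, hsup⟩
    refine ⟨fun n => by rw [hzero n]; exact hf n, fun γ₀ γ hγ => ?_⟩
    set s := X₀.mulVec β₀hat with hs
    set c : Fin P → ℝ := fun p => ∑ n, X n p * (y n - b' (s n)) with hc
    have hg : ∀ g, Real.sqrt (∑ p ∈ Finset.univ.filter (fun p => grp p = g), (c p) ^ 2) ≤ lam :=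
      fun g => (le_ciSup (f := fun g => Real.sqrt
        (∑ p ∈ Finset.univ.filter (fun p => grp p = g), (c p) ^ 2))
        (Set.finite_range _).bddAbove g).trans hsup
    have hA : ∑ p, c p * γ p ≤
        lam * ∑ g, Real.sqrt (∑ p ∈ Finset.univ.filter (fun p => grp p = g), (γ p) ^ 2) := by
      rw [← Finset.sum_fiberwise Finset.univ grp, Finset.mul_sum]
      refine Finset.sum_le_sum fun g _ => ?_
      refine (Real.sum_mul_le_sqrt_mul_sqrt _ _ _).trans ?_
      exact mul_le_mul_of_nonneg_right (hg g) (Real.sqrt_nonneg _)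
    have hB : ∑ n, (y n - b' (s n)) * X.mulVec γ n = ∑ p, c p * γ p := aux_swap X _ γ
    have hC : ∀ v : Fin P₀ → ℝ, ∑ n, (y n - b' (s n)) * X₀.mulVec v n = 0 := fun v => by
      rw [aux_swap X₀ (fun n => y n - b' (s n))]
      exact Finset.sum_eq_zero fun p _ => by rw [h0 p, zero_mul]
    have hD : ∑ n, (y n * (X₀.mulVec γ₀ + X.mulVec γ) n - b ((X₀.mulVec γ₀ + X.mulVec γ) n)) ≤
        ∑ n, ((y n * s n - b (s n)) + (y n - b' (s n)) * X₀.mulVec γ₀ n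
          + (y n - b' (s n)) * X.mulVec γ n - (y n - b' (s n)) * s n) := by
      refine Finset.sum_le_sum fun n _ => ?_
      have := aux_tangent Θ b b' hb hderiv (s n) _ (hf n) (hγ n)
      simp only [Pi.add_apply] at this ⊢
      linarith
    have hC' : ∑ n, (y n - b' (s n)) * s n = 0 := hC β₀hat
    have hF : ∑ n, ((y n * s n - b (s n)) + (y n - b' (s n)) * X₀.mulVec γ₀ n
          + (y n - b' (s n)) * X.mulVec γ n - (y n - b' (s n)) * s n) =
        ∑ n, (y n * s n - b (s n)) + ∑ p, c p * γ p := by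
      rw [Finset.sum_sub_distrib, Finset.sum_add_distrib, Finset.sum_add_distrib, hC, hB, hC']
      ring
    rw [hF] at hD
    have hE : glmGroupLassoObj b X₀ X y lam grp β₀hat 0 = -∑ n, (y n * s n - b (s n)) := by
      simp [glmGroupLassoObj, hs]
    rw [hE]
    unfold glmGroupLassoObj
    linarith
end

section
/- Let X ∈ ℝ^{N×P}, λ ≥ 0 and y ∈ ℝ^N with yₙ ≠ 0 for all n. Then β = 0 is a minimizer of the LAD-lasso objective f(β) = ‖y − Xβ‖₁ + λ‖β‖₁ over ℝ^P if and only if λ ≥ ‖Xᵀ sgn(y)‖_∞, where sgn(y) is the vector of signs of the entries of y. In other words, the zero-thresholding function of the LAD-lasso is λ₀(y) = ‖Xᵀ sgn(y)‖_∞ for y with no zero coordinates. -/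
open Matrix

/-- The LAD-lasso objective `f(β) = ‖y − Xβ‖₁ + λ‖β‖₁`. -/
noncomputable def ladLassoObj {N P : ℕ} (X : Matrix (Fin N) (Fin P) ℝ) (y : Fin N → ℝ)
    (lam : ℝ) (β : Fin P → ℝ) : ℝ :=
  ∑ n, |y n - X.mulVec β n| + lam * ∑ p, |β p|

lemma ladAux_abs (y z : ℝ) (hy : y ≠ 0) (h : |z| ≤ |y|) :
    |y - z| = |y| - z * Real.sign y := by
  have h1 := abs_le.1 h
  rcases lt_or_gt_of_ne hy with h0 | h0
  · rw [Real.sign_of_neg h0]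
    rw [abs_of_neg h0] at *
    rw [abs_of_nonpos (by linarith)]; ring
  · rw [Real.sign_of_pos h0]
    rw [abs_of_pos h0] at *
    rw [abs_of_nonneg (by linarith)]; ring

lemma ladAux_ge (y z : ℝ) (hy : y ≠ 0) :
    |y| - z * Real.sign y ≤ |y - z| := by
  rcases lt_or_gt_of_ne hy with h0 | h0
  · rw [Real.sign_of_neg h0, abs_of_neg h0]
    linarith [neg_le_abs (y - z)]
  · rw [Real.sign_of_pos h0, abs_of_pos h0]
    linarith [le_abs_self (y - z)]

/-- For `y` with no zero coordinate, `β = 0` minimizes the LAD-lasso objective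
iff `λ ≥ ‖Xᵀ sgn(y)‖_∞`: the zero-thresholding function of the LAD-lasso is
`λ₀(y) = ‖Xᵀ sgn(y)‖_∞`. -/
theorem lad_lasso_zero_thresholding {N P : ℕ} (X : Matrix (Fin N) (Fin P) ℝ)
    (y : Fin N → ℝ) (hy : ∀ n, y n ≠ 0) (lam : ℝ) (hlam : 0 ≤ lam) :
    (∀ β : Fin P → ℝ, ladLassoObj X y lam 0 ≤ ladLassoObj X y lam β) ↔
      (⨆ p : Fin P, |∑ n, X n p * Real.sign (y n)|) ≤ lam := by
  constructor
  · intro h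
    refine Real.iSup_le (fun p => ?_) hlam
    have hev : ∀ᶠ ε in nhdsWithin (0:ℝ) (Set.Ioi 0), ∀ n, ε * |X n p| < |y n| := by
      rw [Filter.eventually_all]
      intro n
      have hc : Continuous (fun ε : ℝ => ε * |X n p|) := by fun_prop
      have h0 : (fun ε : ℝ => ε * |X n p|) 0 < |y n| := by simpa using hy n
      exact (hc.continuousAt.eventually_lt continuousAt_const h0).filter_mono nhdsWithin_le_nhds
    obtain ⟨ε, hε, hpos⟩ := (hev.and self_mem_nhdsWithin).exists
    have hpos : 0 < ε := hpos
    have key : ∀ t : ℝ, |t| = ε → t * ∑ n, X n p * Real.sign (y n) ≤ lam * ε := by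
      intro t ht
      have h1 := h (Pi.single p t)
      have h2 : ∀ n, |y n - (X.mulVec (Pi.single p t)) n|
          = |y n| - t * (X n p * Real.sign (y n)) := by
        intro n
        have h3 : (X.mulVec (Pi.single p t)) n = X n p * t := by
          simp [Matrix.mulVec_single]
        rw [h3, ladAux_abs _ _ (hy n)]
        · ring
        · rw [abs_mul, ht, mul_comm]; exact (hε n).le
      have h4 : ∑ q, |(Pi.single p t : Fin P → ℝ) q| = ε := by
        rw [Finset.sum_eq_single p]
        · simpa using ht
        · intro b _ hb; simp [hb]
        · simp
      unfold ladLassoObj at h1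
      simp only [h2, h4, Finset.sum_sub_distrib, ← Finset.mul_sum] at h1
      simp at h1
      linarith
    have ha := key ε (abs_of_pos hpos)
    have hb := key (-ε) (by rw [abs_neg, abs_of_pos hpos])
    apply abs_le.2
    constructor <;> nlinarith
  · intro h β
    have hp : ∀ p, |∑ n, X n p * Real.sign (y n)| ≤ lam := fun p =>
      (le_ciSup (f := fun p : Fin P => |∑ n, X n p * Real.sign (y n)|)
        (Set.finite_range _).bddAbove p).trans h
    have h1 : ∑ n, (|y n| - X.mulVec β n * Real.sign (y n)) ≤ ∑ n, |y n - X.mulVec β n| :=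
      Finset.sum_le_sum fun n _ => ladAux_ge _ _ (hy n)
    have h2 : ∑ n, X.mulVec β n * Real.sign (y n)
        = ∑ p, β p * ∑ n, X n p * Real.sign (y n) := by
      simp only [Matrix.mulVec, dotProduct, Finset.sum_mul, Finset.mul_sum]
      rw [Finset.sum_comm]
      refine Finset.sum_congr rfl fun _ _ => Finset.sum_congr rfl fun _ _ => by ring
    have h3 : ∑ p, β p * ∑ n, X n p * Real.sign (y n) ≤ lam * ∑ p, |β p| := by
      rw [Finset.mul_sum]
      refine Finset.sum_le_sum fun p _ => (le_abs_self _).trans ?_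
      rw [abs_mul, mul_comm]
      exact mul_le_mul_of_nonneg_right (hp p) (abs_nonneg _)
    rw [Finset.sum_sub_distrib, h2] at h1
    have h0 : ladLassoObj X y lam 0 = ∑ n, |y n| := by simp [ladLassoObj]
    rw [h0, ladLassoObj]
    linarith
end

section
/- Let X ∈ ℝ^{N×P}, λ ≥ 0 and y ∈ ℝ^N with y ≠ 0. Then β = 0 is a minimizer of the square root lasso objective f(β) = ‖y − Xβ‖₂ + λ‖β‖₁ over ℝ^P if and only if λ ≥ ‖Xᵀy‖_∞ / ‖y‖₂. In other words, the zero-thresholding function of the square root lasso is λ₀(y) = ‖Xᵀy‖_∞/‖y‖₂. -/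
open Matrix

/-- The square root lasso objective `f(β) = ‖y − Xβ‖₂ + λ‖β‖₁`. -/
noncomputable def sqrtLassoObj {N P : ℕ} (X : Matrix (Fin N) (Fin P) ℝ) (y : Fin N → ℝ)
    (lam : ℝ) (β : Fin P → ℝ) : ℝ :=
  Real.sqrt (∑ n, (y n - X.mulVec β n) ^ 2) + lam * ∑ p, |β p|

/-- For `y ≠ 0`, `β = 0` minimizes the square root lasso objective iff
`λ ≥ ‖Xᵀy‖_∞ / ‖y‖₂`: the zero-thresholding function of the square root lasso
is `λ₀(y) = ‖Xᵀy‖_∞ / ‖y‖₂`. -/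
theorem sqrt_lasso_zero_thresholding {N P : ℕ} (X : Matrix (Fin N) (Fin P) ℝ)
    (y : Fin N → ℝ) (hy : y ≠ 0) (lam : ℝ) (hlam : 0 ≤ lam) :
    (∀ β : Fin P → ℝ, sqrtLassoObj X y lam 0 ≤ sqrtLassoObj X y lam β) ↔
      (⨆ p : Fin P, |∑ n, X n p * y n|) / Real.sqrt (∑ n, (y n) ^ 2) ≤ lam := by
  set s := Real.sqrt (∑ n, (y n) ^ 2) with hs
  have hS : 0 < ∑ n, (y n) ^ 2 := by
    obtain ⟨i, hi⟩ := Function.ne_iff.mp hy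
    exact Finset.sum_pos' (fun n _ => sq_nonneg _) ⟨i, Finset.mem_univ _, by
      have : y i ≠ 0 := hi
      positivity⟩
  have hs0 : 0 < s := Real.sqrt_pos.mpr hS
  have hs2 : s ^ 2 = ∑ n, (y n) ^ 2 := Real.sq_sqrt hS.le
  have h0 : sqrtLassoObj X y lam 0 = s := by
    simp [sqrtLassoObj, hs]
  rw [h0, div_le_iff₀ hs0]
  constructor
  · intro h
    apply Real.iSup_le _ (by positivity)
    intro p
    by_contra! hc
    set c := ∑ n, X n p * y n with hcdef
    set q := ∑ n, (X n p) ^ 2 with hq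
    have hq0 : 0 ≤ q := Finset.sum_nonneg fun n _ => sq_nonneg _
    set d := |c| - lam * s with hd
    have hd0 : 0 < d := by linarith
    have key : ∀ t : ℝ, s ≤ Real.sqrt (s ^ 2 - 2 * t * c + t ^ 2 * q) + lam * |t| := by
      intro t
      have h1 := h (Pi.single p t)
      have e1 : ∑ n, (y n - X.mulVec (Pi.single p t) n) ^ 2
          = s ^ 2 - 2 * t * c + t ^ 2 * q := by
        rw [hs2, hcdef, hq, Finset.mul_sum, Finset.mul_sum, ← Finset.sum_sub_distrib,
          ← Finset.sum_add_distrib]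
        refine Finset.sum_congr rfl fun n _ => ?_
        rw [Matrix.mulVec_single]
        simp
        ring
      have e2 : ∑ i, |(Pi.single p t : Fin P → ℝ) i| = |t| := by
        rw [Finset.sum_eq_single p]
        · simp
        · intro b _ hb
          simp [hb]
        · simp
      unfold sqrtLassoObj at h1
      rwa [e1, e2] at h1
    obtain ⟨ε, he0, he1, he2⟩ : ∃ ε : ℝ, 0 < ε ∧ ε * (lam + 1) ≤ s ∧ ε * (q + 1) ≤ d := by
      refine ⟨min (s / (lam + 1)) (d / (q + 1)), by positivity, ?_, ?_⟩
      · rw [← le_div_iff₀ (by positivity)]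
        exact min_le_left _ _
      · rw [← le_div_iff₀ (by positivity)]
        exact min_le_right _ _
    obtain ⟨t, ht1, ht2⟩ : ∃ t : ℝ, |t| = ε ∧ t * c = ε * |c| := by
      rcases le_total 0 c with h | h
      · exact ⟨ε, abs_of_pos he0, by rw [abs_of_nonneg h]⟩
      · exact ⟨-ε, by rw [abs_neg, abs_of_pos he0], by rw [abs_of_nonpos h]; ring⟩
    have h1 := key t
    have ht3 : t ^ 2 = ε ^ 2 := by rw [← sq_abs, ht1]
    rw [ht1, mul_assoc, ht2, ht3] at h1
    have h2 : 0 < s - lam * ε := by nlinarith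
    have h3 : s - lam * ε ≤ Real.sqrt (s ^ 2 - 2 * (ε * |c|) + ε ^ 2 * q) := by linarith
    rw [Real.le_sqrt' h2] at h3
    have h4 : ε * (2 * d) ≤ ε * (ε * q) := by
      rw [hd]
      nlinarith [sq_nonneg (lam * ε)]
    have h5 := le_of_mul_le_mul_left h4 he0
    nlinarith
  · intro h β
    have hb : ∀ p, |∑ n, X n p * y n| ≤ lam * s := fun p =>
      (le_ciSup (f := fun p : Fin P => |∑ n, X n p * y n|) (Set.finite_range _).bddAbove p).trans h
    have cs := Real.sum_mul_le_sqrt_mul_sqrt Finset.univ y (fun n => y n - X.mulVec β n)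
    rw [← hs] at cs
    have e1 : ∑ n, y n * (y n - X.mulVec β n) = s ^ 2 - ∑ p, (∑ n, X n p * y n) * β p := by
      have : ∑ p, (∑ n, X n p * y n) * β p = ∑ n, y n * X.mulVec β n := by
        simp only [Matrix.mulVec, dotProduct, Finset.sum_mul, Finset.mul_sum]
        rw [Finset.sum_comm]
        exact Finset.sum_congr rfl fun n _ => Finset.sum_congr rfl fun p _ => by ring
      rw [this, hs2, ← Finset.sum_sub_distrib]
      exact Finset.sum_congr rfl fun n _ => by ring
    have e2 : ∑ p, (∑ n, X n p * y n) * β p ≤ lam * s * ∑ p, |β p| := by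
      rw [Finset.mul_sum]
      refine Finset.sum_le_sum fun p _ => ?_
      calc _ ≤ |(∑ n, X n p * y n) * β p| := le_abs_self _
        _ = |∑ n, X n p * y n| * |β p| := abs_mul _ _
        _ ≤ _ := mul_le_mul_of_nonneg_right (hb p) (abs_nonneg _)
    rw [e1] at cs
    unfold sqrtLassoObj
    refine le_of_mul_le_mul_left ?_ hs0
    nlinarith
end

section
/- Let X ∈ ℝ^{N×P}, y ∈ ℝ^N, λ ≥ 0, let {1,…,P} be partitioned into groups G₁, …, G_G, and let X_g denote the submatrix of X with columns indexed by G_g. Then β = 0 is a minimizer of the group lasso objective f(β) = ½‖y − Xβ‖₂² + λ Σ_{g=1}^G ‖β_{G_g}‖₂ over ℝ^P if and only if λ ≥ max_{g=1,…,G} ‖X_gᵀy‖₂. In other words, the zero-thresholding function of the group lasso is λ₀(y) = max_g ‖X_gᵀy‖₂. -/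
open Matrix

/-- The group lasso objective `f(β) = ½‖y − Xβ‖₂² + λ ∑_g ‖β_{G_g}‖₂`,
where the groups `G_g` are the fibers of `grp : Fin P → Fin G`. -/
noncomputable def groupLassoObj {N P G : ℕ} (X : Matrix (Fin N) (Fin P) ℝ) (y : Fin N → ℝ)
    (lam : ℝ) (grp : Fin P → Fin G) (β : Fin P → ℝ) : ℝ :=
  (1 / 2) * ∑ n, (y n - X.mulVec β n) ^ 2
    + lam * ∑ g, Real.sqrt (∑ p ∈ Finset.univ.filter (fun p => grp p = g), (β p) ^ 2)

lemma obj_expand {N P G : ℕ} (X : Matrix (Fin N) (Fin P) ℝ) (y : Fin N → ℝ)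
    (lam : ℝ) (grp : Fin P → Fin G) (β : Fin P → ℝ) :
    groupLassoObj X y lam grp β = groupLassoObj X y lam grp 0
      - ∑ p, (∑ n, X n p * y n) * β p + (1 / 2) * ∑ n, (X.mulVec β n) ^ 2
      + lam * ∑ g, Real.sqrt (∑ p ∈ Finset.univ.filter (fun p => grp p = g), (β p) ^ 2) := by
  have h : ∑ p, (∑ n, X n p * y n) * β p = ∑ n, y n * X.mulVec β n := by
    simp only [Matrix.mulVec, dotProduct, Finset.sum_mul, Finset.mul_sum]
    rw [Finset.sum_comm]
    refine Finset.sum_congr rfl fun n _ => Finset.sum_congr rfl fun p _ => by ring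
  have h2 : ∑ n, (y n - X.mulVec β n) ^ 2
      = ∑ n, (y n) ^ 2 - 2 * ∑ n, y n * X.mulVec β n + ∑ n, (X.mulVec β n) ^ 2 := by
    rw [Finset.mul_sum, ← Finset.sum_sub_distrib, ← Finset.sum_add_distrib]
    refine Finset.sum_congr rfl fun n _ => by ring
  rw [h]
  unfold groupLassoObj
  rw [h2]
  simp
  ring

theorem group_lasso_zero_thresholding {N P G : ℕ} (X : Matrix (Fin N) (Fin P) ℝ)
    (y : Fin N → ℝ) (lam : ℝ) (hlam : 0 ≤ lam) (grp : Fin P → Fin G) :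
    (∀ β : Fin P → ℝ, groupLassoObj X y lam grp 0 ≤ groupLassoObj X y lam grp β) ↔
      (⨆ g : Fin G, Real.sqrt (∑ p ∈ Finset.univ.filter (fun p => grp p = g),
        (∑ n, X n p * y n) ^ 2)) ≤ lam := by
  constructor
  · intro H
    refine Real.iSup_le (fun g => ?_) hlam
    set c : Fin P → ℝ := fun p => ∑ n, X n p * y n with hc
    set s := ∑ p ∈ Finset.univ.filter (fun p => grp p = g), (c p) ^ 2 with hs
    change Real.sqrt s ≤ lam
    have hs0 : 0 ≤ s := Finset.sum_nonneg fun p _ => sq_nonneg _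
    let b : Fin P → ℝ := fun p => if grp p = g then c p else 0
    set K := ∑ n, (X.mulVec b n) ^ 2 with hK
    have hK0 : 0 ≤ K := Finset.sum_nonneg fun p _ => sq_nonneg _
    have key : ∀ t : ℝ, 0 < t → s ≤ t * K / 2 + lam * Real.sqrt s := by
      intro t ht
      have h := H (t • b)
      rw [obj_expand X y lam grp (t • b)] at h
      have e1 : ∑ p, (∑ n, X n p * y n) * (t • b) p = t * s := by
        rw [hs, Finset.sum_filter, Finset.mul_sum]
        refine Finset.sum_congr rfl fun p _ => ?_
        simp only [Pi.smul_apply, smul_eq_mul, b]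
        split_ifs
        · simp only [hc]; ring
        · simp
      have e2 : ∑ n, (X.mulVec (t • b) n) ^ 2 = t ^ 2 * K := by
        rw [Matrix.mulVec_smul, hK, Finset.mul_sum]
        refine Finset.sum_congr rfl fun n _ => ?_
        simp only [Pi.smul_apply, smul_eq_mul]; ring
      have e3 : ∑ g', Real.sqrt (∑ p ∈ Finset.univ.filter (fun p => grp p = g'),
          ((t • b) p) ^ 2) = t * Real.sqrt s := by
        rw [Finset.sum_eq_single g]
        · have : ∑ p ∈ Finset.univ.filter (fun p => grp p = g), ((t • b) p) ^ 2
              = t ^ 2 * s := by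
            rw [hs, Finset.mul_sum]
            refine Finset.sum_congr rfl fun p hp => ?_
            have hp' : grp p = g := by simpa using hp
            simp only [Pi.smul_apply, smul_eq_mul, b, if_pos hp']; ring
          rw [this, Real.sqrt_mul (sq_nonneg t), Real.sqrt_sq ht.le]
        · intro g' _ hg'
          rw [Finset.sum_eq_zero, Real.sqrt_zero]
          intro p hp
          have hp' : grp p = g' := by simpa using hp
          have : grp p ≠ g := by rw [hp']; exact hg'
          simp [b, this]
        · simp
      rw [e1, e2, e3] at h
      have h3 : t * s ≤ t * (t * K / 2 + lam * Real.sqrt s) := by nlinarith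
      exact le_of_mul_le_mul_left h3 ht
    have hfin : s ≤ lam * Real.sqrt s := by
      refine le_of_forall_pos_le_add fun ε hε => ?_
      have h := key (ε / (K + 1)) (by positivity)
      have : ε / (K + 1) * K / 2 ≤ ε := by
        rw [div_mul_eq_mul_div, div_div, div_le_iff₀ (by positivity)]
        nlinarith
      linarith
    rcases (Real.sqrt_nonneg s).eq_or_lt with h0 | h0
    · rw [← h0]; exact hlam
    · refine le_of_mul_le_mul_right ?_ h0
      rwa [Real.mul_self_sqrt hs0]
  · intro H β
    rw [obj_expand X y lam grp β]
    have hK0 : 0 ≤ ∑ n, (X.mulVec β n) ^ 2 := Finset.sum_nonneg fun p _ => sq_nonneg _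
    have : ∑ p, (∑ n, X n p * y n) * β p ≤
        lam * ∑ g, Real.sqrt (∑ p ∈ Finset.univ.filter (fun p => grp p = g), (β p) ^ 2) := by
      rw [← Finset.sum_fiberwise Finset.univ grp, Finset.mul_sum]
      refine Finset.sum_le_sum fun g _ => ?_
      refine (Real.sum_mul_le_sqrt_mul_sqrt _ _ _).trans ?_
      refine mul_le_mul_of_nonneg_right ?_ (Real.sqrt_nonneg _)
      exact (le_ciSup (f := fun g : Fin G => Real.sqrt (∑ p ∈ Finset.univ.filter
        (fun p => grp p = g), (∑ n, X n p * y n) ^ 2)) (Set.finite_range _).bddAbove g).trans H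
    linarith
end

section
/- Let X ∈ ℝ^{N×P}, λ ≥ 0, y ∈ ℝ^N with y ≠ 0, let {1,…,P} be partitioned into groups G₁, …, G_G, and let X_g denote the submatrix of X with columns indexed by G_g. Then β = 0 is a minimizer of the group square root lasso objective f(β) = ‖y − Xβ‖₂ + λ Σ_{g=1}^G ‖β_{G_g}‖₂ over ℝ^P if and only if λ ≥ max_{g=1,…,G} ‖X_gᵀy‖₂ / ‖y‖₂. In other words, the zero-thresholding function of the group square root lasso is λ₀(y) = max_g ‖X_gᵀy‖₂/‖y‖₂. -/
open Matrix

/-- The group square root lasso objective `f(β) = ‖y − Xβ‖₂ + λ ∑_g ‖β_{G_g}‖₂`,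
where the groups `G_g` are the fibers of `grp : Fin P → Fin G`. -/
noncomputable def groupSqrtLassoObj {N P G : ℕ} (X : Matrix (Fin N) (Fin P) ℝ)
    (y : Fin N → ℝ) (lam : ℝ) (grp : Fin P → Fin G) (β : Fin P → ℝ) : ℝ :=
  Real.sqrt (∑ n, (y n - X.mulVec β n) ^ 2)
    + lam * ∑ g, Real.sqrt (∑ p ∈ Finset.univ.filter (fun p => grp p = g), (β p) ^ 2)

lemma gsl_swap {N P : ℕ} (X : Matrix (Fin N) (Fin P) ℝ) (y : Fin N → ℝ) (b : Fin P → ℝ) :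
    ∑ n, y n * X.mulVec b n = ∑ p, (∑ n, X n p * y n) * b p := by
  simp only [Matrix.mulVec, dotProduct, Finset.mul_sum, Finset.sum_mul]
  rw [Finset.sum_comm]
  refine Finset.sum_congr rfl fun p _ => Finset.sum_congr rfl fun n _ => by ring

lemma gsl_expand {N : ℕ} (y z : Fin N → ℝ) (t : ℝ) :
    ∑ n, (y n - t * z n) ^ 2 = ∑ n, y n ^ 2 - 2 * t * ∑ n, y n * z n + t ^ 2 * ∑ n, z n ^ 2 := by
  simp only [Finset.mul_sum, ← Finset.sum_sub_distrib, ← Finset.sum_add_distrib]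
  refine Finset.sum_congr rfl fun n _ => by ring

lemma gsl_zero {N P G : ℕ} (X : Matrix (Fin N) (Fin P) ℝ)
    (y : Fin N → ℝ) (lam : ℝ) (grp : Fin P → Fin G) :
    groupSqrtLassoObj X y lam grp 0 = Real.sqrt (∑ n, (y n) ^ 2) := by
  simp [groupSqrtLassoObj]

/-- For `y ≠ 0`, `β = 0` minimizes the group square root lasso objective iff
`λ ≥ max_g ‖X_gᵀy‖₂ / ‖y‖₂`: the zero-thresholding function of the group square
root lasso is `λ₀(y) = max_g ‖X_gᵀy‖₂ / ‖y‖₂`. -/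
theorem group_sqrt_lasso_zero_thresholding {N P G : ℕ} (X : Matrix (Fin N) (Fin P) ℝ)
    (y : Fin N → ℝ) (hy : y ≠ 0) (lam : ℝ) (hlam : 0 ≤ lam) (grp : Fin P → Fin G) :
    (∀ β : Fin P → ℝ, groupSqrtLassoObj X y lam grp 0 ≤ groupSqrtLassoObj X y lam grp β) ↔
      (⨆ g : Fin G, Real.sqrt (∑ p ∈ Finset.univ.filter (fun p => grp p = g),
        (∑ n, X n p * y n) ^ 2)) / Real.sqrt (∑ n, (y n) ^ 2) ≤ lam := by
  have hS2 : 0 < ∑ n, (y n) ^ 2 := by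
    obtain ⟨n, hn⟩ := Function.ne_iff.mp hy
    exact Finset.sum_pos' (fun _ _ => sq_nonneg _) ⟨n, Finset.mem_univ _, by
      have : y n ≠ 0 := hn
      positivity⟩
  have hS : 0 < Real.sqrt (∑ n, (y n) ^ 2) := Real.sqrt_pos.mpr hS2
  have hSS := Real.sq_sqrt hS2.le
  rw [div_le_iff₀ hS]
  simp only [gsl_zero]
  set S := Real.sqrt (∑ n, (y n) ^ 2) with hSdef
  set c : Fin P → ℝ := fun p => ∑ n, X n p * y n with hc
  constructor
  · intro h
    refine Real.iSup_le (fun g => ?_) (by positivity)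
    by_contra! hlt
    have hM2 : 0 ≤ ∑ p ∈ Finset.univ.filter (fun p => grp p = g), (c p) ^ 2 :=
      Finset.sum_nonneg fun _ _ => sq_nonneg _
    have hMM := Real.sq_sqrt hM2
    change lam * S < Real.sqrt (∑ p ∈ Finset.univ.filter (fun p => grp p = g), (c p) ^ 2) at hlt
    set M := Real.sqrt (∑ p ∈ Finset.univ.filter (fun p => grp p = g), (c p) ^ 2) with hM
    have hMpos : 0 < M := lt_of_le_of_lt (by positivity) hlt
    set b : Fin P → ℝ := fun p => if grp p = g then c p else 0 with hb
    set K := ∑ n, (X.mulVec b n) ^ 2 with hK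
    have hK0 : 0 ≤ K := Finset.sum_nonneg fun _ _ => sq_nonneg _
    have hyb : ∑ n, y n * X.mulVec b n = M ^ 2 := by
      rw [gsl_swap, hMM, Finset.sum_filter]
      refine Finset.sum_congr rfl fun p _ => ?_
      simp only [hb]
      split_ifs <;> simp [hc, sq]
    have key : ∀ t : ℝ, 0 < t → S ≤ Real.sqrt (S ^ 2 - 2 * t * M ^ 2 + t ^ 2 * K) + lam * (t * M) := by
      intro t ht
      have h1 := h (t • b)
      unfold groupSqrtLassoObj at h1
      simp only [Matrix.mulVec_smul, Pi.smul_apply, smul_eq_mul] at h1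
      rw [gsl_expand, hyb, ← hSS] at h1
      have h2 : ∑ g', Real.sqrt (∑ p ∈ Finset.univ.filter (fun p => grp p = g'), (t * b p) ^ 2)
          = t * M := by
        rw [Finset.sum_eq_single g]
        · rw [hM, ← Real.sqrt_sq ht.le, ← Real.sqrt_mul (sq_nonneg _), Real.sqrt_sq ht.le,
            Finset.mul_sum]
          congr 1
          refine Finset.sum_congr rfl fun p hp => ?_
          have hp' : grp p = g := by simpa using hp
          simp only [hb, if_pos hp']
          ring
        · intro g' _ hg'
          rw [Finset.sum_eq_zero, Real.sqrt_zero]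
          intro p hp
          have hp' : grp p = g' := by simpa using hp
          have : grp p ≠ g := by rw [hp']; exact hg'
          simp [hb, if_neg this]
        · simp
      rw [h2] at h1
      exact h1
    have key2 : ∀ t : ℝ, 0 < t → 2 * M ^ 2 - t * K ≤ 2 * S * lam * M := by
      intro t ht
      have h1 := key t ht
      have hnn : 0 ≤ S ^ 2 - 2 * t * M ^ 2 + t ^ 2 * K := by
        have := gsl_expand y (X.mulVec b) t
        rw [hyb, ← hSS] at this
        rw [← this]
        exact Finset.sum_nonneg fun _ _ => sq_nonneg _
      have h2 := Real.sq_sqrt hnn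
      set q := Real.sqrt (S ^ 2 - 2 * t * M ^ 2 + t ^ 2 * K)
      have h3 : t * (2 * M ^ 2 - t * K) ≤ t * (2 * S * lam * M) := by
        nlinarith [sq_nonneg (q - S), mul_le_mul_of_nonneg_left h1 hS.le]
      exact le_of_mul_le_mul_left h3 ht
    have hd : 0 < M * (M - lam * S) := mul_pos hMpos (by linarith)
    have h4 := key2 (M * (M - lam * S) / (K + 1)) (by positivity)
    have h5 : M * (M - lam * S) / (K + 1) * K ≤ M * (M - lam * S) := by
      rw [div_mul_eq_mul_div, div_le_iff₀ (by positivity)]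
      nlinarith
    nlinarith
  · intro h β
    have hg : ∀ g, Real.sqrt (∑ p ∈ Finset.univ.filter (fun p => grp p = g), (c p) ^ 2)
        ≤ lam * S := fun g => le_trans (le_ciSup (f := fun g => Real.sqrt
          (∑ p ∈ Finset.univ.filter (fun p => grp p = g), (c p) ^ 2))
          (Set.finite_range _).bddAbove g) h
    have hcs := Real.sum_mul_le_sqrt_mul_sqrt Finset.univ y (fun n => y n - X.mulVec β n)
    have e1 : ∑ n, y n * (y n - X.mulVec β n) = S ^ 2 - ∑ p, c p * β p := by
      rw [hSS, ← gsl_swap, ← Finset.sum_sub_distrib]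
      refine Finset.sum_congr rfl fun n _ => by ring
    have e2 : ∑ p, c p * β p ≤ lam * S * ∑ g, Real.sqrt (∑ p ∈ Finset.univ.filter (fun p => grp p = g), (β p) ^ 2) := by
      rw [← Finset.sum_fiberwise Finset.univ grp, Finset.mul_sum]
      refine Finset.sum_le_sum fun g _ => ?_
      exact (Real.sum_mul_le_sqrt_mul_sqrt _ c β).trans
        (mul_le_mul_of_nonneg_right (hg g) (Real.sqrt_nonneg _))
    rw [e1] at hcs
    unfold groupSqrtLassoObj
    refine le_of_mul_le_mul_left ?_ hS
    rw [mul_add]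
    nlinarith
end

section
/- Let X ∈ ℝ^{N×P} with columns x₁, …, x_P, y ∈ ℝ^N, λ ≥ 0, and let w₁, …, w_P > 0 be positive weights with W = diag(w₁, …, w_P). Then β = 0 is a minimizer of the adaptive lasso objective f(β) = ½‖y − Xβ‖₂² + λ Σ_{p=1}^P |β_p|/w_p over ℝ^P if and only if λ ≥ ‖W Xᵀ y‖_∞ = max_p w_p |x_pᵀy|. In other words, the zero-thresholding function of the adaptive lasso is λ₀(y) = ‖W Xᵀy‖_∞. -/
open Matrix

/-- The adaptive lasso objective `f(β) = ½‖y − Xβ‖₂² + λ ∑_p |β_p| / w_p`. -/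
noncomputable def adaptiveLassoObj {N P : ℕ} (X : Matrix (Fin N) (Fin P) ℝ) (y : Fin N → ℝ)
    (lam : ℝ) (w : Fin P → ℝ) (β : Fin P → ℝ) : ℝ :=
  (1 / 2) * ∑ n, (y n - X.mulVec β n) ^ 2 + lam * ∑ p, |β p| / w p

lemma adaptiveLassoObj_expand {N P : ℕ} (X : Matrix (Fin N) (Fin P) ℝ) (y : Fin N → ℝ)
    (lam : ℝ) (w : Fin P → ℝ) (β : Fin P → ℝ) :
    adaptiveLassoObj X y lam w β = adaptiveLassoObj X y lam w 0
      + (∑ p, (lam * (|β p| / w p) - β p * ∑ n, X n p * y n))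
      + (1 / 2) * ∑ n, (X.mulVec β n) ^ 2 := by
  have h : ∑ p, β p * ∑ n, X n p * y n = ∑ n, y n * X.mulVec β n := by
    simp only [Matrix.mulVec, dotProduct, Finset.mul_sum]
    rw [Finset.sum_comm]
    exact Finset.sum_congr rfl fun n _ => Finset.sum_congr rfl fun p _ => by ring
  have h2 : ∑ n, (y n - X.mulVec β n) ^ 2
      = ∑ n, y n ^ 2 - 2 * ∑ n, y n * X.mulVec β n + ∑ n, (X.mulVec β n) ^ 2 := by
    rw [Finset.mul_sum, ← Finset.sum_sub_distrib, ← Finset.sum_add_distrib]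
    exact Finset.sum_congr rfl fun n _ => by ring
  rw [Finset.sum_sub_distrib, h, ← Finset.mul_sum]
  simp only [adaptiveLassoObj, h2]
  simp
  ring

/-- For positive weights `w`, `β = 0` minimizes the adaptive lasso objective iff
`λ ≥ ‖W Xᵀ y‖_∞ = max_p w_p |x_pᵀ y|`: the zero-thresholding function of the
adaptive lasso is `λ₀(y) = ‖W Xᵀ y‖_∞`. -/
theorem adaptive_lasso_zero_thresholding {N P : ℕ} (X : Matrix (Fin N) (Fin P) ℝ)
    (y : Fin N → ℝ) (lam : ℝ) (hlam : 0 ≤ lam)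
    (w : Fin P → ℝ) (hw : ∀ p, 0 < w p) :
    (∀ β : Fin P → ℝ, adaptiveLassoObj X y lam w 0 ≤ adaptiveLassoObj X y lam w β) ↔
      (⨆ p : Fin P, w p * |∑ n, X n p * y n|) ≤ lam := by
  constructor
  · intro h
    refine Real.iSup_le (fun p => ?_) hlam
    set c := ∑ n, X n p * y n with hc
    by_contra! hlt
    have hwp := hw p
    set A := ∑ n, (X n p) ^ 2 with hA
    have hA0 : 0 ≤ A := Finset.sum_nonneg fun n _ => sq_nonneg _
    have key : ∀ t : ℝ, 0 ≤ lam * (|t| / w p) - t * c + (1 / 2) * (t ^ 2 * A) := by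
      intro t
      have h1 := h (Pi.single p t)
      rw [adaptiveLassoObj_expand X y lam w (Pi.single p t)] at h1
      have e1 : ∑ q, (lam * (|(Pi.single p t : Fin P → ℝ) q| / w q)
          - (Pi.single p t : Fin P → ℝ) q * ∑ n, X n q * y n)
          = lam * (|t| / w p) - t * c := by
        rw [Finset.sum_eq_single p]
        · simp [hc]
        · intro q _ hq
          simp [Pi.single_eq_of_ne hq]
        · simp
      have e2 : ∑ n, (X.mulVec (Pi.single p t) n) ^ 2 = t ^ 2 * A := by
        rw [hA, Finset.mul_sum]
        refine Finset.sum_congr rfl fun n _ => ?_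
        simp [Matrix.mulVec_single]
        ring
      rw [e1, e2] at h1
      linarith
    set d := |c| - lam / w p with hd
    have hdpos : 0 < d := by
      rw [hd, sub_pos, div_lt_iff₀ hwp]
      linarith
    have key2 : ∀ e : ℝ, 0 < e → 0 ≤ -(e * d) + (1 / 2) * (e ^ 2 * A) := by
      intro e he
      rcases le_total 0 c with h0 | h0
      · have := key e
        rw [abs_of_pos he] at this
        rw [hd, abs_of_nonneg h0]
        have e3 : lam * (e / w p) = e * (lam / w p) := by ring
        linarith
      · have := key (-e)
        rw [abs_neg, abs_of_pos he] at this
        rw [hd, abs_of_nonpos h0]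
        have e3 : lam * (e / w p) = e * (lam / w p) := by ring
        linarith
    have he : 0 < d / (A + 1) := by positivity
    have k := key2 _ he
    have e4 : d / (A + 1) * (A + 1) = d := by field_simp
    set e := d / (A + 1)
    nlinarith [mul_pos he he, mul_nonneg (mul_pos he he).le hA0]
  · intro h β
    rw [adaptiveLassoObj_expand X y lam w β]
    have h1 : 0 ≤ ∑ p, (lam * (|β p| / w p) - β p * ∑ n, X n p * y n) := by
      refine Finset.sum_nonneg fun p _ => ?_
      have hp : w p * |∑ n, X n p * y n| ≤ lam :=
        (le_ciSup (f := fun p : Fin P => w p * |∑ n, X n p * y n|)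
          (Set.finite_range _).bddAbove p).trans h
      have hwp := hw p
      set c := ∑ n, X n p * y n
      have h3 : β p * c ≤ |β p| * |c| := (le_abs_self _).trans (abs_mul _ _).le
      have h4 : (w p * |c|) * (|β p| / w p) ≤ lam * (|β p| / w p) :=
        mul_le_mul_of_nonneg_right hp (by positivity)
      have h5 : (w p * |c|) * (|β p| / w p) = |β p| * |c| := by field_simp
      linarith
    have h2 : 0 ≤ ∑ n, (X.mulVec β n) ^ 2 := Finset.sum_nonneg fun n _ => sq_nonneg _
    linarith
end

section
/- Let X ∈ ℝ^{N×P}, y ∈ ℝ^N, λ⁽¹⁾ ≥ 0 and λ⁽²⁾ ≥ 0. Then β = 0 is a minimizer of the elastic net objective f(β) = ½‖y − Xβ‖₂² + λ⁽¹⁾‖β‖₁ + λ⁽²⁾‖β‖₂² over ℝ^P if and only if λ⁽¹⁾ ≥ ‖Xᵀy‖_∞, regardless of the value of λ⁽²⁾. -/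
open Matrix

/-- The elastic net objective `f(β) = ½‖y − Xβ‖₂² + λ⁽¹⁾‖β‖₁ + λ⁽²⁾‖β‖₂²`. -/
noncomputable def elasticNetObj {N P : ℕ} (X : Matrix (Fin N) (Fin P) ℝ) (y : Fin N → ℝ)
    (lam1 lam2 : ℝ) (β : Fin P → ℝ) : ℝ :=
  (1 / 2) * ∑ n, (y n - X.mulVec β n) ^ 2 + lam1 * ∑ p, |β p| + lam2 * ∑ p, (β p) ^ 2

theorem elasticNetObj_expand {N P : ℕ} (X : Matrix (Fin N) (Fin P) ℝ) (y : Fin N → ℝ)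
    (lam1 lam2 : ℝ) (β : Fin P → ℝ) :
    elasticNetObj X y lam1 lam2 β = elasticNetObj X y lam1 lam2 0
      - ∑ p, (∑ n, X n p * y n) * β p + (1 / 2) * ∑ n, (X.mulVec β n) ^ 2
      + lam1 * ∑ p, |β p| + lam2 * ∑ p, (β p) ^ 2 := by
  have h : ∑ p, (∑ n, X n p * y n) * β p = ∑ n, y n * X.mulVec β n := by
    simp only [Matrix.mulVec, dotProduct, Finset.sum_mul, Finset.mul_sum]
    rw [Finset.sum_comm]
    refine Finset.sum_congr rfl fun n _ => Finset.sum_congr rfl fun p _ => by ring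
  have h2 : ∑ n, (y n - X.mulVec β n) ^ 2
      = ∑ n, (y n) ^ 2 - 2 * ∑ n, y n * X.mulVec β n + ∑ n, (X.mulVec β n) ^ 2 := by
    rw [Finset.mul_sum, ← Finset.sum_sub_distrib, ← Finset.sum_add_distrib]
    refine Finset.sum_congr rfl fun n _ => by ring
  rw [h]
  unfold elasticNetObj
  rw [h2]
  simp
  ring

/-- `β = 0` minimizes the elastic net objective iff `λ⁽¹⁾ ≥ ‖Xᵀy‖_∞`,
regardless of the value of `λ⁽²⁾`. -/
theorem elastic_net_zero_thresholding {N P : ℕ} (X : Matrix (Fin N) (Fin P) ℝ)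
    (y : Fin N → ℝ) (lam1 lam2 : ℝ) (hlam1 : 0 ≤ lam1) (hlam2 : 0 ≤ lam2) :
    (∀ β : Fin P → ℝ, elasticNetObj X y lam1 lam2 0 ≤ elasticNetObj X y lam1 lam2 β) ↔
      (⨆ p : Fin P, |∑ n, X n p * y n|) ≤ lam1 := by
  constructor
  · intro h
    refine Real.iSup_le (fun p => ?_) hlam1
    set c := ∑ n, X n p * y n with hc
    have key : ∀ t : ℝ, 0 ≤ -(c * t) + (1 / 2 * ∑ n, (X n p) ^ 2 + lam2) * t ^ 2
        + lam1 * |t| := by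
      intro t
      have h1 := h (Pi.single p t)
      rw [elasticNetObj_expand X y lam1 lam2 (Pi.single p t)] at h1
      have e1 : ∑ q, (∑ n, X n q * y n) * (Pi.single p t : Fin P → ℝ) q = c * t := by
        rw [Finset.sum_eq_single p] <;> simp +contextual [hc]
      have e2 : ∑ n, (X.mulVec (Pi.single p t) n) ^ 2 = (∑ n, (X n p) ^ 2) * t ^ 2 := by
        rw [Finset.sum_mul]
        refine Finset.sum_congr rfl fun n _ => ?_
        simp [Matrix.mulVec, mul_pow]
      have e3 : ∑ q, |(Pi.single p t : Fin P → ℝ) q| = |t| := by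
        rw [Finset.sum_eq_single p] <;> simp +contextual
      have e4 : ∑ q, ((Pi.single p t : Fin P → ℝ) q) ^ 2 = t ^ 2 := by
        rw [Finset.sum_eq_single p] <;> simp +contextual
      rw [e1, e2, e3, e4] at h1
      linarith
    have hS : 0 ≤ ∑ n, (X n p) ^ 2 := Finset.sum_nonneg fun n _ => sq_nonneg _
    set K := 1 / 2 * ∑ n, (X n p) ^ 2 + lam2 with hK
    have hK0 : 0 ≤ K := by positivity
    by_contra! hlt
    have hd : 0 < |c| - lam1 := by linarith
    obtain ⟨ε, hε, hε2⟩ : ∃ ε : ℝ, 0 < ε ∧ (K + 1) * ε = |c| - lam1 :=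
      ⟨(|c| - lam1) / (K + 1), by positivity, by field_simp⟩
    have h3 : 0 ≤ -(|c| * ε) + K * ε ^ 2 + lam1 * ε := by
      rcases le_total 0 c with h0 | h0
      · have := key ε
        rwa [abs_of_pos hε, ← abs_of_nonneg h0] at this
      · have := key (-ε)
        rw [abs_neg, abs_of_pos hε] at this
        rw [abs_of_nonpos h0]
        linarith
    have h4 : lam1 = |c| - (K + 1) * ε := by linarith
    rw [h4] at h3
    nlinarith [sq_pos_of_pos hε]
  · intro h β
    rw [elasticNetObj_expand X y lam1 lam2 β]
    have h1 : ∑ p, (∑ n, X n p * y n) * β p ≤ lam1 * ∑ p, |β p| := by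
      rw [Finset.mul_sum]
      refine Finset.sum_le_sum fun p _ => ?_
      have hp : |∑ n, X n p * y n| ≤ lam1 :=
        (le_ciSup (f := fun p : Fin P => |∑ n, X n p * y n|)
          (Set.finite_range _).bddAbove p).trans h
      calc _ ≤ |(∑ n, X n p * y n) * β p| := le_abs_self _
        _ = |∑ n, X n p * y n| * |β p| := abs_mul _ _
        _ ≤ _ := mul_le_mul_of_nonneg_right hp (abs_nonneg _)
    have h2 : 0 ≤ ∑ n, (X.mulVec β n) ^ 2 := Finset.sum_nonneg fun n _ => sq_nonneg _
    have h3 : 0 ≤ lam2 * ∑ p, (β p) ^ 2 :=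
      mul_nonneg hlam2 (Finset.sum_nonneg fun n _ => sq_nonneg _)
    linarith
end

section
/- Let X ∈ ℝ^{N×P}, y ∈ ℝ^N, λ ≥ 0, and let B ∈ ℝ^{Q×P} have full row rank. Let I ⊆ {1,…,P} with |I| = Q be a set of column indices such that B_I, the Q×Q submatrix of B with columns indexed by I, is invertible, and let Ī be its complement. Set A₁ = X_I B_I^{−1} and A₂ = X_Ī − X_I B_I^{−1} B_Ī, and let P_{A₂} be the orthogonal projection matrix onto the column space of A₂. Then there exists a minimizer β̂ of the generalized lasso objective f(β) = ½‖y − Xβ‖₂² + λ‖Bβ‖₁ over ℝ^P satisfying Bβ̂ = 0 if and only if λ ≥ ‖A₁ᵀ(I_N − P_{A₂})y‖_∞. In other words, the zero-thresholding function of the generalized lasso is λ₀(y) = ‖A₁ᵀ(I_N − P_{A₂})y‖_∞. -/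
open Matrix

/-- The generalized lasso objective `f(β) = ½‖y − Xβ‖₂² + λ‖Bβ‖₁`. -/
noncomputable def genLassoObj {N P Q : ℕ} (X : Matrix (Fin N) (Fin P) ℝ)
    (B : Matrix (Fin Q) (Fin P) ℝ) (y : Fin N → ℝ) (lam : ℝ) (β : Fin P → ℝ) : ℝ :=
  (1 / 2) * ∑ n, (y n - X.mulVec β n) ^ 2 + lam * ∑ q, |B.mulVec β q|


lemma aux_split {R P Q : ℕ} (M : Matrix (Fin R) (Fin P) ℝ) (e : Fin Q ↪ Fin P) (β : Fin P → ℝ) :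
    M *ᵥ β = M.submatrix id e *ᵥ (β ∘ e) +
      M.submatrix id (Subtype.val : {p : Fin P // p ∉ Set.range e} → Fin P) *ᵥ (β ∘ Subtype.val) := by
  classical
  ext i
  simp only [mulVec, dotProduct, Pi.add_apply, submatrix_apply, id, Function.comp]
  rw [← Fintype.sum_subtype_add_sum_subtype (fun p => p ∈ Set.range e) (fun p => M i p * β p)]
  congr 1
  symm
  refine Fintype.sum_equiv (Equiv.ofInjective e e.injective) (fun q => M i (e q) * β (e q))
    (fun p => M i p.1 * β p.1) (fun q => ?_) |>.trans ?_
  · simp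
  · exact Finset.sum_congr (by ext; simp) (fun _ _ => rfl)

lemma aux_obj {N P Q : ℕ} (X : Matrix (Fin N) (Fin P) ℝ)
    (B : Matrix (Fin Q) (Fin P) ℝ) (y : Fin N → ℝ) (lam : ℝ) (β : Fin P → ℝ) (r d : Fin N → ℝ)
    (h : y - X *ᵥ β = r - d) :
    genLassoObj X B y lam β = (1/2) * (r ⬝ᵥ r) - r ⬝ᵥ d + (1/2) * (d ⬝ᵥ d)
      + lam * ∑ q, |(B *ᵥ β) q| := by
  have h1 : ∑ n, (y n - X.mulVec β n) ^ 2 = (r - d) ⬝ᵥ (r - d) := by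
    rw [← h]; simp [dotProduct, pow_two]
  unfold genLassoObj
  rw [h1, sub_dotProduct, dotProduct_sub, dotProduct_sub, dotProduct_comm d r]
  ring

/-- Zero-thresholding function of the generalized lasso: for `B` of full row
rank, `I` a set of `Q` column indices (encoded by the embedding `e`) with `B_I`
invertible, `A₁ = X_I B_I⁻¹`, `A₂ = X_Ī − X_I B_I⁻¹ B_Ī`, and `Pr` the
orthogonal projection matrix onto the column space of `A₂` (symmetric,
idempotent, with range equal to the column space of `A₂`), there exists a
minimizer `β̂` of the generalized lasso objective with `Bβ̂ = 0` iff
`λ ≥ ‖A₁ᵀ(I_N − Pr)y‖_∞`. -/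
theorem generalized_lasso_zero_thresholding {N P Q : ℕ}
    (X : Matrix (Fin N) (Fin P) ℝ) (B : Matrix (Fin Q) (Fin P) ℝ)
    (y : Fin N → ℝ) (lam : ℝ) (hlam : 0 ≤ lam)
    (hrank : B.rank = Q)
    (e : Fin Q ↪ Fin P)
    (hBI : IsUnit (B.submatrix (id : Fin Q → Fin Q) e))
    (A₁ : Matrix (Fin N) (Fin Q) ℝ)
    (hA₁ : A₁ = X.submatrix id e * (B.submatrix id e)⁻¹)
    (A₂ : Matrix (Fin N) {p : Fin P // p ∉ Set.range e} ℝ)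
    (hA₂ : A₂ = X.submatrix id (Subtype.val : {p : Fin P // p ∉ Set.range e} → Fin P)
      - X.submatrix id e * (B.submatrix id e)⁻¹
        * B.submatrix id (Subtype.val : {p : Fin P // p ∉ Set.range e} → Fin P))
    (Pr : Matrix (Fin N) (Fin N) ℝ)
    (hPr_symm : Prᵀ = Pr) (hPr_idem : Pr * Pr = Pr)
    (hPr_range : LinearMap.range Pr.mulVecLin = LinearMap.range A₂.mulVecLin) :
    (∃ βhat : Fin P → ℝ, B.mulVec βhat = 0 ∧
        ∀ β : Fin P → ℝ, genLassoObj X B y lam βhat ≤ genLassoObj X B y lam β) ↔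
      (⨆ q : Fin Q, |∑ n, A₁ n q * (y n - Pr.mulVec y n)|) ≤ lam := by
  classical
  have hdet : IsUnit (B.submatrix (id : Fin Q → Fin Q) e).det := (isUnit_iff_isUnit_det _).1 hBI
  have hX : ∀ β : Fin P → ℝ, X *ᵥ β = A₁ *ᵥ (B *ᵥ β) + A₂ *ᵥ (β ∘ Subtype.val) := by
    intro β
    rw [aux_split X e β, aux_split B e β, hA₁, hA₂, mulVec_add, mulVec_mulVec, mulVec_mulVec,
      Matrix.nonsing_inv_mul_cancel_right _ _ hdet, sub_mulVec]
    abel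
  have hex : ∀ (θ : Fin Q → ℝ) (v : {p : Fin P // p ∉ Set.range e} → ℝ),
      ∃ β : Fin P → ℝ, B *ᵥ β = θ ∧ β ∘ Subtype.val = v := by
    intro θ v
    set w := (B.submatrix (id : Fin Q → Fin Q) e)⁻¹ *ᵥ (θ - B.submatrix id (Subtype.val : {p : Fin P // p ∉ Set.range e} → Fin P) *ᵥ v) with hw
    let β : Fin P → ℝ := fun p => if h : p ∈ Set.range e then w h.choose else v ⟨p, h⟩
    have h1 : β ∘ e = w := by
      ext q
      have hq : e q ∈ Set.range e := ⟨q, rfl⟩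
      have : hq.choose = q := e.injective hq.choose_spec
      simp only [β, Function.comp, dif_pos hq, this]
    have h2 : β ∘ Subtype.val = v := by
      ext p
      simp only [β, Function.comp, dif_neg p.2]
    refine ⟨β, ?_, h2⟩
    rw [aux_split B e β, h1, h2, hw, mulVec_mulVec, Matrix.mul_nonsing_inv _ hdet, one_mulVec]
    abel
  obtain ⟨v0, hv0⟩ : ∃ v0, A₂ *ᵥ v0 = Pr *ᵥ y := by
    have : Pr *ᵥ y ∈ LinearMap.range A₂.mulVecLin := hPr_range ▸ ⟨y, rfl⟩
    exact this
  set r := y - Pr *ᵥ y with hr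
  have hPr0 : Pr *ᵥ r = 0 := by
    rw [hr, mulVec_sub, mulVec_mulVec, hPr_idem, sub_self]
  have horth : ∀ v, r ⬝ᵥ (A₂ *ᵥ v) = 0 := by
    intro v
    have : A₂ *ᵥ v ∈ LinearMap.range Pr.mulVecLin := hPr_range ▸ ⟨v, rfl⟩
    obtain ⟨z, hz⟩ := this
    rw [← hz, mulVecLin_apply, dotProduct_mulVec, ← mulVec_transpose, hPr_symm, hPr0,
      zero_dotProduct]
  have hobj : ∀ β : Fin P → ℝ, ∃ d, y - X *ᵥ β = r - d ∧ r ⬝ᵥ d = (r ᵥ* A₁) ⬝ᵥ (B *ᵥ β) := by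
    intro β
    refine ⟨A₁ *ᵥ (B *ᵥ β) + A₂ *ᵥ (β ∘ Subtype.val - v0), ?_, ?_⟩
    · rw [hX β, mulVec_sub, hv0, hr]; abel
    · rw [dotProduct_add, horth, add_zero, dotProduct_mulVec]
  have hc : ∀ q, ∑ n, A₁ n q * (y n - Pr.mulVec y n) = (r ᵥ* A₁) q := by
    intro q
    simp [vecMul, dotProduct, hr, mul_comm]
  simp only [hc]
  have hnn : ∀ d : Fin N → ℝ, 0 ≤ d ⬝ᵥ d := fun d => 
    Finset.sum_nonneg fun i _ => mul_self_nonneg _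
  constructor
  · rintro ⟨b, hb0, hb⟩
    refine Real.iSup_le (fun q => ?_) hlam
    have hlow : ∀ β, (1/2) * (r ⬝ᵥ r) ≤ genLassoObj X B y lam β := by
      intro β
      refine le_trans ?_ (hb β)
      obtain ⟨d, hd, hd2⟩ := hobj b
      rw [aux_obj X B y lam b r d hd, hd2, hb0]
      have := hnn d
      simp
      linarith
    have key : ∀ s : ℝ, |s| = 1 → s * (r ᵥ* A₁) q ≤ lam := by
      intro s hs
      set a := A₁ *ᵥ Pi.single q s with ha
      have hra : r ⬝ᵥ a = s * (r ᵥ* A₁) q := by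
        rw [ha, dotProduct_mulVec, dotProduct_single, mul_comm]
      have h1 : ∀ t : ℝ, 0 < t → s * (r ᵥ* A₁) q ≤ lam + t * (a ⬝ᵥ a) := by
        intro t ht
        obtain ⟨β, hβ, hβ2⟩ := hex (t • Pi.single q s) v0
        have h := hlow β
        rw [aux_obj X B y lam β r (t • a) (by
          rw [hX, hβ, hβ2, mulVec_smul, hv0, hr, ha]; abel), hβ] at h
        have hs1 : ∑ q', |(t • (Pi.single q s : Fin Q → ℝ)) q'| = t := by
          rw [Finset.sum_eq_single q]
          · simp [abs_mul, hs, abs_of_pos ht]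
          · intro b _ hbq
            simp [hbq]
          · simp
        rw [hs1, dotProduct_smul, dotProduct_smul, smul_dotProduct, hra] at h
        simp only [smul_eq_mul] at h
        have h2 : t * (s * (r ᵥ* A₁) q) ≤ t * (lam + t * (a ⬝ᵥ a)) := by
          have := mul_nonneg (mul_nonneg ht.le ht.le) (hnn a)
          nlinarith
        exact le_of_mul_le_mul_left h2 ht
      refine le_of_forall_pos_le_add fun ε hε => ?_
      have hpos : 0 < a ⬝ᵥ a + 1 := by have := hnn a; linarith
      refine (h1 (ε / (a ⬝ᵥ a + 1)) (by positivity)).trans ?_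
      have : ε / (a ⬝ᵥ a + 1) * (a ⬝ᵥ a) ≤ ε := by
        rw [div_mul_eq_mul_div, div_le_iff₀ hpos]
        nlinarith
      linarith
    rw [abs_le]
    have k1 := key 1 (by simp)
    have k2 := key (-1) (by simp)
    constructor <;> linarith
  · intro h
    obtain ⟨b, hb, hb2⟩ := hex 0 v0
    refine ⟨b, hb, fun β => ?_⟩
    have hle : ∀ q, |(r ᵥ* A₁) q| ≤ lam := fun q =>
      (le_ciSup (f := fun q => |(r ᵥ* A₁) q|) (Set.finite_range _).bddAbove q).trans h
    obtain ⟨d, hd, hd2⟩ := hobj β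
    rw [aux_obj X B y lam β r d hd, aux_obj X B y lam b r 0 (by
      rw [hX, hb, hb2, hv0, hr]; simp), hb, hd2]
    have h3 : (r ᵥ* A₁) ⬝ᵥ (B *ᵥ β) ≤ lam * ∑ q, |(B *ᵥ β) q| := by
      rw [Finset.mul_sum]
      refine Finset.sum_le_sum fun q _ => ?_
      refine (le_abs_self _).trans ?_
      rw [abs_mul]
      exact mul_le_mul_of_nonneg_right (hle q) (abs_nonneg _)
    have := hnn d
    simp
    linarith
end

section
/- Let N ≥ 2, y ∈ ℝ^N, λ ≥ 0, and let B ∈ ℝ^{(N−1)×N} be the first order difference matrix, (Bβ)_k = β_{k+1} − β_k for k = 1, …, N−1. Then the (unique) minimizer β̂ of the one-dimensional total variation objective f(β) = ½‖y − β‖₂² + λ‖Bβ‖₁ over ℝ^N satisfies Bβ̂ = 0 (i.e., β̂ is a constant vector) if and only if λ ≥ ‖(BBᵀ)^{−1}By‖_∞. In other words, the zero-thresholding function of one-dimensional total variation is λ₀(y) = ‖(BBᵀ)^{−1}By‖_∞. -/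
open Matrix

/-- The one-dimensional total variation objective
`f(β) = ½‖y − β‖₂² + λ‖Bβ‖₁`, `B` being the first order difference matrix. -/
noncomputable def tvObj {n : ℕ} (B : Matrix (Fin n) (Fin (n + 1)) ℝ)
    (y : Fin (n + 1) → ℝ) (lam : ℝ) (β : Fin (n + 1) → ℝ) : ℝ :=
  (1 / 2) * ∑ i, (y i - β i) ^ 2 + lam * ∑ k, |B.mulVec β k|

/-- Zero-thresholding function of one-dimensional total variation (here
`N = n + 1 ≥ 2`): a minimizer `β̂` of `½‖y − β‖₂² + λ‖Bβ‖₁`, with `B` the first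
order difference matrix `(Bβ)_k = β_{k+1} − β_k`, satisfies `Bβ̂ = 0` (i.e. `β̂`
is constant) iff `λ ≥ ‖(BBᵀ)⁻¹By‖_∞`. -/
theorem tv1d_zero_thresholding {n : ℕ} (hn : 1 ≤ n)
    (y : Fin (n + 1) → ℝ) (lam : ℝ) (hlam : 0 ≤ lam)
    (B : Matrix (Fin n) (Fin (n + 1)) ℝ)
    (hB : ∀ (k : Fin n) (β : Fin (n + 1) → ℝ),
      B.mulVec β k = β k.succ - β k.castSucc)
    (βhat : Fin (n + 1) → ℝ)
    (hmin : ∀ β : Fin (n + 1) → ℝ, tvObj B y lam βhat ≤ tvObj B y lam β) :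
    B.mulVec βhat = 0 ↔
      (⨆ k : Fin n, |(B * Bᵀ)⁻¹.mulVec (B.mulVec y) k|) ≤ lam := by
  -- the step vectors
  have hstep : ∀ k : Fin n, B.mulVec (fun i => if k.castSucc < i then (1:ℝ) else 0) = Pi.single k 1 := by
    intro k
    ext j
    rw [hB]
    simp only [Fin.lt_def, Fin.val_succ, Fin.val_castSucc, Pi.single_apply, Fin.ext_iff]
    split_ifs <;> first | omega | norm_num
  have hadj : ∀ (u : Fin n → ℝ) (h : Fin (n+1) → ℝ), (Bᵀ *ᵥ u) ⬝ᵥ h = u ⬝ᵥ (B *ᵥ h) := by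
    intro u h
    rw [Matrix.mulVec_transpose, Matrix.dotProduct_mulVec]
  have hinj : Function.Injective (B * Bᵀ).mulVec := by
    have h0 : ∀ v, (B * Bᵀ) *ᵥ v = 0 → v = 0 := by
      intro v hv
      have h1 : (Bᵀ *ᵥ v) ⬝ᵥ (Bᵀ *ᵥ v) = 0 := by
        rw [hadj, Matrix.mulVec_mulVec, hv, dotProduct_zero]
      have h2 := dotProduct_self_eq_zero.mp h1
      ext k
      have h3 := hadj v (fun i => if k.castSucc < i then (1:ℝ) else 0)
      rw [h2, hstep, zero_dotProduct, dotProduct_single] at h3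
      simpa using h3.symm
    intro a b hab
    have := h0 (a - b) (by rw [Matrix.mulVec_sub]; exact sub_eq_zero.mpr hab)
    exact sub_eq_zero.mp this
  have hunit : IsUnit (B * Bᵀ) := Matrix.mulVec_injective_iff_isUnit.mp hinj
  have hdet : IsUnit (B * Bᵀ).det := (Matrix.isUnit_iff_isUnit_det _).mp hunit
  set u := (B * Bᵀ)⁻¹.mulVec (B.mulVec y) with hu
  obtain ⟨c, hc⟩ : ∃ c, c = y - Bᵀ *ᵥ u := ⟨_, rfl⟩
  have hBc : B *ᵥ c = 0 := by
    rw [hc, Matrix.mulVec_sub, Matrix.mulVec_mulVec, hu, Matrix.mulVec_mulVec,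
      Matrix.mul_nonsing_inv _ hdet, Matrix.one_mulVec, sub_self]
  have hexp : ∀ h : Fin (n+1) → ℝ, tvObj B y lam (c + h) = tvObj B y lam c
      - u ⬝ᵥ (B *ᵥ h) + (1/2) * ∑ i, h i ^ 2 + lam * ∑ k, |(B *ᵥ h) k| := by
    intro h
    have e1 : ∑ i, (y i - (c + h) i) ^ 2
        = ∑ i, (y i - c i)^2 - 2 * ((Bᵀ *ᵥ u) ⬝ᵥ h) + ∑ i, h i ^ 2 := by
      have : Bᵀ *ᵥ u = y - c := by rw [hc]; abel
      rw [this]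
      simp only [dotProduct, Finset.mul_sum, ← Finset.sum_sub_distrib, ← Finset.sum_add_distrib]
      refine Finset.sum_congr rfl fun i _ => ?_
      simp only [Pi.add_apply, Pi.sub_apply]
      ring
    unfold tvObj
    rw [e1, hadj, Matrix.mulVec_add, hBc]
    simp
    ring
  have hsq : ∀ h : Fin (n+1) → ℝ, ∑ i, h i ^ 2 ≤ 0 → h = 0 := by
    intro h hh
    have h1 : ∑ i, h i ^ 2 = 0 := le_antisymm hh (Finset.sum_nonneg fun i _ => sq_nonneg _)
    ext i
    have := (Finset.sum_eq_zero_iff_of_nonneg (fun i _ => sq_nonneg (h i))).mp h1 i (Finset.mem_univ i)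
    simpa using this
  have hβ : βhat = c + (βhat - c) := by abel
  haveI : Nonempty (Fin n) := ⟨⟨0, hn⟩⟩
  constructor
  · intro h0
    have hz : B *ᵥ (βhat - c) = 0 := by rw [Matrix.mulVec_sub, h0, hBc, sub_self]
    have h1 := hmin c
    rw [hβ, hexp, hz] at h1
    simp only [dotProduct_zero, Pi.zero_apply, abs_zero, Finset.sum_const_zero] at h1
    have h2 := hsq (βhat - c) (by linarith)
    have h3 : βhat = c := sub_eq_zero.mp h2
    refine ciSup_le fun k => ?_
    by_contra! hlt
    obtain ⟨C, hC⟩ : ∃ C, C = ∑ i : Fin (n+1), (if k.castSucc < i then (1:ℝ) else 0) ^ 2 := ⟨_, rfl⟩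
    have hC0 : 0 ≤ C := hC ▸ Finset.sum_nonneg fun i _ => sq_nonneg _
    have key : ∀ t : ℝ, t * u k ≤ (1/2) * (t^2 * C) + lam * |t| := by
      intro t
      have h4 := hmin (c + t • (fun i => if k.castSucc < i then (1:ℝ) else 0))
      rw [h3, hexp, Matrix.mulVec_smul, hstep, dotProduct_smul, dotProduct_single] at h4
      have e1 : ∑ j, |(t • (Pi.single k (1:ℝ) : Fin n → ℝ)) j| = |t| := by
        rw [Finset.sum_eq_single k]
        · simp
        · intro b _ hb
          simp [hb]
        · simp
      have e2 : ∑ i, (t • (fun i : Fin (n+1) => if k.castSucc < i then (1:ℝ) else 0)) i ^ 2 = t^2 * C := by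
        rw [hC, Finset.mul_sum]
        refine Finset.sum_congr rfl fun i _ => ?_
        simp only [Pi.smul_apply, smul_eq_mul, mul_pow]
      rw [e1, e2] at h4
      simp only [smul_eq_mul, mul_one] at h4
      linarith
    have key2 : ∀ t : ℝ, 0 < t → |u k| ≤ (1/2) * (t * C) + lam := by
      intro t ht
      have a := key t
      have b := key (-t)
      rw [abs_neg, abs_of_pos ht] at b
      rw [abs_of_pos ht] at a
      rw [abs_le]
      constructor
      · refine le_of_mul_le_mul_left ?_ ht
        linarith
      · refine le_of_mul_le_mul_left ?_ ht
        linarith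
    have hd : 0 < |u k| - lam := by linarith
    have h5 := key2 ((|u k| - lam) / (C + 1)) (by positivity)
    have h6 : (|u k| - lam) / (C + 1) * C ≤ |u k| - lam := by
      rw [div_mul_eq_mul_div, div_le_iff₀ (by positivity)]
      nlinarith
    linarith
  · intro hle
    have hk : ∀ k, |u k| ≤ lam := fun k =>
      (le_ciSup (f := fun k => |u k|) (Set.finite_range _).bddAbove k).trans hle
    have h1 := hmin c
    rw [hβ, hexp] at h1
    have h2 : u ⬝ᵥ (B *ᵥ (βhat - c)) ≤ lam * ∑ k, |(B *ᵥ (βhat - c)) k| := by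
      rw [dotProduct, Finset.mul_sum]
      refine Finset.sum_le_sum fun k _ => ?_
      refine (le_abs_self _).trans ?_
      rw [abs_mul]
      exact mul_le_mul_of_nonneg_right (hk k) (abs_nonneg _)
    have h3 : βhat = c := sub_eq_zero.mp (hsq (βhat - c) (by linarith))
    rw [h3, hBc]
end

section
/- Let X ∈ ℝ^{N×P} with orthonormal columns (XᵀX = I_P), y ∈ ℝ^N and λ ≥ 0. Then β = 0 is a minimizer of the best subset selection objective f(β) = ½‖y − Xβ‖₂² + λ‖β‖₀ over ℝ^P if and only if λ ≥ ½‖Xᵀy‖_∞². In other words, for orthonormal X the zero-thresholding function of best subset selection is λ₀(y) = Δ₁(y) = ½ max_p (x_pᵀy)². -/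
open Matrix

/-- The best subset selection objective `f(β) = ½‖y − Xβ‖₂² + λ‖β‖₀`. -/
noncomputable def bestSubsetObj {N P : ℕ} (X : Matrix (Fin N) (Fin P) ℝ) (y : Fin N → ℝ)
    (lam : ℝ) (β : Fin P → ℝ) : ℝ :=
  (1 / 2) * ∑ n, (y n - X.mulVec β n) ^ 2
    + lam * (Finset.univ.filter (fun p => β p ≠ 0)).card

theorem bestSubsetObj_expand {N P : ℕ}
    (X : Matrix (Fin N) (Fin P) ℝ) (hX : Xᵀ * X = 1)
    (y : Fin N → ℝ) (lam : ℝ) (β : Fin P → ℝ) :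
    bestSubsetObj X y lam β = (1 / 2) * ∑ n, y n ^ 2 +
      ∑ p, ((1 / 2) * β p ^ 2 - (∑ n, X n p * y n) * β p + if β p ≠ 0 then lam else 0) := by
  have h1 : ∑ n, (X.mulVec β n) ^ 2 = ∑ p, β p ^ 2 := by
    have : X.mulVec β ⬝ᵥ X.mulVec β = β ⬝ᵥ β := by
      rw [Matrix.dotProduct_mulVec, Matrix.vecMul_mulVec, hX, Matrix.vecMul_one]
    simpa [dotProduct, sq] using this
  have h2 : ∑ n, y n * X.mulVec β n = ∑ p, (∑ n, X n p * y n) * β p := by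
    simp only [Matrix.mulVec, dotProduct, Finset.mul_sum, Finset.sum_mul]
    rw [Finset.sum_comm]
    refine Finset.sum_congr rfl fun p _ => Finset.sum_congr rfl fun n _ => by ring
  have h3 : ∑ n, (y n - X.mulVec β n) ^ 2 = ∑ n, y n ^ 2 - 2 * ∑ n, y n * X.mulVec β n
      + ∑ n, (X.mulVec β n) ^ 2 := by
    rw [Finset.mul_sum, ← Finset.sum_sub_distrib, ← Finset.sum_add_distrib]
    refine Finset.sum_congr rfl fun n _ => by ring
  have h4 : ∑ p, (if β p ≠ 0 then lam else 0) =
      lam * (Finset.univ.filter (fun p => β p ≠ 0)).card := by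
    rw [← Finset.sum_filter, Finset.sum_const, nsmul_eq_mul, mul_comm]
  unfold bestSubsetObj
  rw [Finset.sum_add_distrib, h4, Finset.sum_sub_distrib, ← Finset.mul_sum, ← h1, ← h2, h3]
  ring

/-- For `X` with orthonormal columns, `β = 0` minimizes the best subset
selection objective iff `λ ≥ ½‖Xᵀy‖_∞²`: the zero-thresholding function of
best subset selection is `λ₀(y) = Δ₁(y) = ½ max_p (x_pᵀy)²`. -/
theorem best_subset_orthonormal_zero_thresholding {N P : ℕ}
    (X : Matrix (Fin N) (Fin P) ℝ) (hX : Xᵀ * X = 1)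
    (y : Fin N → ℝ) (lam : ℝ) (hlam : 0 ≤ lam) :
    (∀ β : Fin P → ℝ, bestSubsetObj X y lam 0 ≤ bestSubsetObj X y lam β) ↔
      (1 / 2) * (⨆ p : Fin P, |∑ n, X n p * y n|) ^ 2 ≤ lam := by
  set c : Fin P → ℝ := fun p => ∑ n, X n p * y n with hc
  have h0 : bestSubsetObj X y lam 0 = (1 / 2) * ∑ n, y n ^ 2 := by
    rw [bestSubsetObj_expand X hX]; simp
  have key : (1 / 2) * (⨆ p : Fin P, |c p|) ^ 2 ≤ lam ↔ ∀ p, (1 / 2) * c p ^ 2 ≤ lam := by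
    constructor
    · intro h p
      have h1 : |c p| ≤ ⨆ p : Fin P, |c p| :=
        le_ciSup (f := fun p => |c p|) (Set.finite_range _).bddAbove p
      have h2 := pow_le_pow_left₀ (abs_nonneg _) h1 2
      rw [sq_abs] at h2
      linarith
    · intro h
      rcases isEmpty_or_nonempty (Fin P) with hP | hP
      · rw [Real.iSup_of_isEmpty]; simpa using hlam
      · obtain ⟨p, hp⟩ := exists_eq_ciSup_of_finite (f := fun p => |c p|)
        rw [← hp]
        simpa only [sq_abs] using h p
  refine Iff.trans ?_ key.symm
  rw [h0]
  constructor
  · intro h p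
    by_cases hp : c p = 0
    · rw [hp]; simpa using hlam
    have := h (Pi.single p (c p))
    rw [bestSubsetObj_expand X hX, Finset.sum_eq_single p] at this
    · simp only [Pi.single_eq_same, ne_eq, hp, not_false_eq_true, if_true] at this
      change _ ≤ _ + (_ - c p * c p + lam) at this
      nlinarith
    · intro q _ hq
      simp [Pi.single_eq_of_ne hq]
    · simp
  · intro h β
    rw [bestSubsetObj_expand X hX]
    refine le_add_of_nonneg_right (Finset.sum_nonneg fun p _ => ?_)
    change 0 ≤ _ - c p * β p + _
    split_ifs with hb
    · nlinarith [h p, sq_nonneg (β p - c p)]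
    · simp [not_not.mp hb]
end

section
/- Let X ∈ ℝ^{N×P} with orthonormal columns (XᵀX = I_P), y ∈ ℝ^N, λ⁽¹⁾ ≥ 0 and λ⁽²⁾ ≥ 0. Consider the fused lasso objective f_{λ⁽¹⁾,λ⁽²⁾}(β) = ½‖y − Xβ‖₂² + λ⁽¹⁾‖β‖₁ + λ⁽²⁾ Σ_{p=2}^P |β_p − β_{p−1}|, and let β̂_{(0,λ⁽²⁾)}(y) denote the (unique) minimizer of f_{0,λ⁽²⁾}. Then β = 0 is a minimizer of f_{λ⁽¹⁾,λ⁽²⁾} over ℝ^P if and only if λ⁽¹⁾ ≥ ‖β̂_{(0,λ⁽²⁾)}(y)‖_∞. In other words, for fixed λ⁽²⁾ the zero-thresholding function of the fused lasso in λ⁽¹⁾ is λ⁽¹⁾₀(y; λ⁽²⁾) = ‖β̂_{(0,λ⁽²⁾)}(y)‖_∞. -/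
open Matrix

/-- The fused lasso objective
`f(β) = ½‖y − Xβ‖₂² + λ⁽¹⁾‖β‖₁ + λ⁽²⁾ ∑_{p=2}^P |β_p − β_{p−1}|`
(here `P = m + 1`). -/
noncomputable def fusedLassoObj {N m : ℕ} (X : Matrix (Fin N) (Fin (m + 1)) ℝ)
    (y : Fin N → ℝ) (lam1 lam2 : ℝ) (β : Fin (m + 1) → ℝ) : ℝ :=
  (1 / 2) * ∑ n, (y n - X.mulVec β n) ^ 2 + lam1 * ∑ p, |β p|
    + lam2 * ∑ k : Fin m, |β k.succ - β k.castSucc|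

noncomputable def flTV {m : ℕ} (β : Fin (m + 1) → ℝ) : ℝ :=
  ∑ k : Fin m, |β k.succ - β k.castSucc|

theorem fl_expand {N m : ℕ} (X : Matrix (Fin N) (Fin (m + 1)) ℝ) (hX : Xᵀ * X = 1)
    (y : Fin N → ℝ) (l1 l2 : ℝ) (β : Fin (m + 1) → ℝ) :
    fusedLassoObj X y l1 l2 β = (1 / 2) * (y ⬝ᵥ y) + (1 / 2) * (β ⬝ᵥ β)
      - (Xᵀ *ᵥ y) ⬝ᵥ β + l1 * ∑ p, |β p| + l2 * flTV β := by
  have h1 : ∑ n, (y n - X.mulVec β n) ^ 2 = (y - X *ᵥ β) ⬝ᵥ (y - X *ᵥ β) := by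
    simp [dotProduct, sq]
  have h2 : (X *ᵥ β) ⬝ᵥ (X *ᵥ β) = β ⬝ᵥ β := by
    rw [Matrix.dotProduct_mulVec, ← Matrix.mulVec_transpose, Matrix.mulVec_mulVec, hX,
      Matrix.one_mulVec]
  have h3 : y ⬝ᵥ (X *ᵥ β) = (Xᵀ *ᵥ y) ⬝ᵥ β := by
    rw [Matrix.dotProduct_mulVec, ← Matrix.mulVec_transpose]
  have h4 : (X *ᵥ β) ⬝ᵥ y = (Xᵀ *ᵥ y) ⬝ᵥ β := by
    rw [dotProduct_comm, h3]
  unfold fusedLassoObj flTV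
  rw [h1, sub_dotProduct, dotProduct_sub, dotProduct_sub, h2, h3, h4]
  ring

theorem fl_limit (a c : ℝ) (h : ∀ t : ℝ, 0 < t → t ≤ 1 → 0 ≤ t * a + t ^ 2 * c) : 0 ≤ a := by
  by_contra! ha
  have hc : 0 < |c| + 1 := by positivity
  have hd : 0 < |c| + 1 - a := by linarith
  have ht : 0 < -a / (|c| + 1 - a) := div_pos (by linarith) hd
  have ht1 : -a / (|c| + 1 - a) ≤ 1 := by rw [div_le_one hd]; linarith
  have h0 := h _ ht ht1
  set t := -a / (|c| + 1 - a) with htd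
  have h1 : 0 ≤ t * (a + t * c) := by linarith [h0, show t * (a + t * c) = t * a + t ^ 2 * c by ring]
  have h2 : 0 ≤ a + t * c := nonneg_of_mul_nonneg_right h1 ht
  have h3 : t * (|c| + 1 - a) = -a := by rw [htd]; field_simp
  have h4 : t * c ≤ t * |c| := mul_le_mul_of_nonneg_left (le_abs_self c) ht.le
  nlinarith [mul_pos ht (show 0 < 1 - a by linarith)]

theorem flTV_add {m : ℕ} (b d : Fin (m + 1) → ℝ) : flTV (b + d) ≤ flTV b + flTV d := by
  unfold flTV
  rw [← Finset.sum_add_distrib]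
  refine Finset.sum_le_sum fun k _ => ?_
  have := abs_add_le (b k.succ - b k.castSucc) (d k.succ - d k.castSucc)
  simp only [Pi.add_apply]
  have e : b k.succ + d k.succ - (b k.castSucc + d k.castSucc)
      = (b k.succ - b k.castSucc) + (d k.succ - d k.castSucc) := by ring
  rw [e]
  exact this

theorem flTV_smul {m : ℕ} (t : ℝ) (ht : 0 ≤ t) (b : Fin (m + 1) → ℝ) :
    flTV (t • b) = t * flTV b := by
  unfold flTV
  rw [Finset.mul_sum]
  refine Finset.sum_congr rfl fun k _ => ?_
  simp only [Pi.smul_apply, smul_eq_mul]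
  rw [← mul_sub, abs_mul, abs_of_nonneg ht]

theorem fl_l1_smul {m : ℕ} (t : ℝ) (ht : 0 ≤ t) (b : Fin (m + 1) → ℝ) :
    ∑ p, |(t • b) p| = t * ∑ p, |b p| := by
  rw [Finset.mul_sum]
  refine Finset.sum_congr rfl fun k _ => ?_
  simp only [Pi.smul_apply, smul_eq_mul]
  rw [abs_mul, abs_of_nonneg ht]

noncomputable def flClip (l x : ℝ) : ℝ := max (-l) (min x l)

theorem flClip_tv (l : ℝ) (hl : 0 ≤ l) (x y : ℝ) :
    |x - y| = |flClip l x - flClip l y| + |(x - flClip l x) - (y - flClip l y)| := by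
  wlog h : y ≤ x generalizing x y
  · rw [abs_sub_comm x y, abs_sub_comm (flClip l x), abs_sub_comm (x - flClip l x)]
    exact this y x (by linarith)
  have h1 : flClip l y ≤ flClip l x := by unfold flClip; gcongr
  have h2 : y - flClip l y ≤ x - flClip l x := by
    unfold flClip; grind
  rw [abs_of_nonneg (by linarith), abs_of_nonneg (by linarith), abs_of_nonneg (by linarith)]
  ring

theorem flClip_mul (l : ℝ) (hl : 0 ≤ l) (x : ℝ) :
    x * (x - flClip l x) = l * |x - flClip l x| + (x - flClip l x) ^ 2 := by
  unfold flClip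
  rcases le_total x l with h | h
  · rw [min_eq_left h]
    rcases le_total x (-l) with h' | h'
    · rw [max_eq_left h', abs_of_nonpos (by linarith)]; ring
    · rw [max_eq_right h']; simp
  · rw [min_eq_right h, max_eq_right (by linarith), abs_of_nonneg (by linarith)]; ring

theorem flClip_abs (l : ℝ) (hl : 0 ≤ l) (x : ℝ) (h : x - flClip l x = 0) : |x| ≤ l := by
  unfold flClip at h
  rw [abs_le]
  grind

/-- For `X` with orthonormal columns and `β̂_{(0,λ⁽²⁾)}` the minimizer of the
fused lasso objective with `λ⁽¹⁾ = 0`, `β = 0` minimizes the fused lasso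
objective iff `λ⁽¹⁾ ≥ ‖β̂_{(0,λ⁽²⁾)}(y)‖_∞`: for fixed `λ⁽²⁾`, the
zero-thresholding function of the fused lasso in `λ⁽¹⁾` is
`λ⁽¹⁾₀(y; λ⁽²⁾) = ‖β̂_{(0,λ⁽²⁾)}(y)‖_∞`. -/
theorem fused_lasso_zero_thresholding {N m : ℕ}
    (X : Matrix (Fin N) (Fin (m + 1)) ℝ) (hX : Xᵀ * X = 1)
    (y : Fin N → ℝ) (lam1 lam2 : ℝ) (hlam1 : 0 ≤ lam1) (hlam2 : 0 ≤ lam2)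
    (βhat : Fin (m + 1) → ℝ)
    (hβhat : ∀ β : Fin (m + 1) → ℝ, fusedLassoObj X y 0 lam2 βhat ≤ fusedLassoObj X y 0 lam2 β) :
    (∀ β : Fin (m + 1) → ℝ,
        fusedLassoObj X y lam1 lam2 0 ≤ fusedLassoObj X y lam1 lam2 β) ↔
      (⨆ p : Fin (m + 1), |βhat p|) ≤ lam1 := by
  set z := Xᵀ *ᵥ y with hz
  have hd : ∀ d : Fin (m + 1) → ℝ, z ⬝ᵥ d - βhat ⬝ᵥ d ≤ lam2 * flTV d := by
    intro d
    have := fl_limit (βhat ⬝ᵥ d - z ⬝ᵥ d + lam2 * flTV d) ((1 / 2) * (d ⬝ᵥ d)) (by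
      intro t ht _
      have h := hβhat (βhat + t • d)
      rw [fl_expand X hX, fl_expand X hX, ← hz] at h
      have h1 := mul_le_mul_of_nonneg_left (flTV_add βhat (t • d)) hlam2
      rw [flTV_smul t ht.le] at h1
      simp only [dotProduct_add, add_dotProduct, dotProduct_smul, smul_dotProduct,
        smul_eq_mul, dotProduct_comm d βhat] at h
      nlinarith)
    linarith
  have hb : lam2 * flTV βhat ≤ z ⬝ᵥ βhat - βhat ⬝ᵥ βhat := by
    have := fl_limit (z ⬝ᵥ βhat - βhat ⬝ᵥ βhat - lam2 * flTV βhat)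
      ((1 / 2) * (βhat ⬝ᵥ βhat)) (by
      intro t ht ht1
      have h := hβhat ((1 - t) • βhat)
      rw [fl_expand X hX, fl_expand X hX, ← hz, flTV_smul _ (by linarith)] at h
      simp only [dotProduct_smul, smul_dotProduct, smul_eq_mul] at h
      nlinarith)
    linarith
  have h0 : fusedLassoObj X y lam1 lam2 0 = (1 / 2) * (y ⬝ᵥ y) := by
    rw [fl_expand X hX]; simp [flTV]
  constructor
  · intro hmin
    have hall : ∀ d : Fin (m + 1) → ℝ, z ⬝ᵥ d ≤ lam1 * ∑ p, |d p| + lam2 * flTV d := by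
      intro d
      have := fl_limit (lam1 * ∑ p, |d p| + lam2 * flTV d - z ⬝ᵥ d) ((1 / 2) * (d ⬝ᵥ d)) (by
        intro t ht _
        have h := hmin (t • d)
        rw [h0, fl_expand X hX, ← hz, flTV_smul t ht.le, fl_l1_smul t ht.le] at h
        simp only [dotProduct_smul, smul_dotProduct, smul_eq_mul] at h
        nlinarith)
      linarith
    set c : Fin (m + 1) → ℝ := fun p => flClip lam1 (βhat p) with hc
    set s : Fin (m + 1) → ℝ := fun p => βhat p - flClip lam1 (βhat p) with hs
    have hcs : c + s = βhat := by ext p; simp [hc, hs]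
    have htv : flTV βhat = flTV c + flTV s := by
      unfold flTV
      rw [← Finset.sum_add_distrib]
      exact Finset.sum_congr rfl fun k _ => flClip_tv lam1 hlam1 _ _
    have e1 : z ⬝ᵥ βhat = z ⬝ᵥ c + z ⬝ᵥ s := by rw [← dotProduct_add, hcs]
    have e2 : βhat ⬝ᵥ βhat = βhat ⬝ᵥ c + βhat ⬝ᵥ s := by rw [← dotProduct_add, hcs]
    have e3 : βhat ⬝ᵥ s = lam1 * ∑ p, |s p| + ∑ p, s p ^ 2 := by
      rw [Finset.mul_sum, ← Finset.sum_add_distrib]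
      exact Finset.sum_congr rfl fun p _ => flClip_mul lam1 hlam1 _
    have hle : ∑ p, s p ^ 2 ≤ 0 := by
      have := hall s
      have := hd c
      rw [htv, e1, e2] at hb
      linarith
    refine ciSup_le fun p => flClip_abs lam1 hlam1 _ ?_
    have h5 : s p ^ 2 ≤ ∑ p, s p ^ 2 :=
      Finset.single_le_sum (f := fun p => s p ^ 2) (fun _ _ => sq_nonneg _) (Finset.mem_univ p)
    have h6 : s p ^ 2 = 0 := le_antisymm (by linarith) (sq_nonneg _)
    exact pow_eq_zero_iff (two_ne_zero) |>.1 h6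
  · intro hsup β
    have hp : ∀ p, |βhat p| ≤ lam1 := fun p =>
      (le_ciSup (f := fun p => |βhat p|) (Set.finite_range _).bddAbove p).trans hsup
    have h1 : βhat ⬝ᵥ β ≤ lam1 * ∑ p, |β p| := by
      rw [Finset.mul_sum]
      refine Finset.sum_le_sum fun p _ => ?_
      calc βhat p * β p ≤ |βhat p * β p| := le_abs_self _
        _ = |βhat p| * |β p| := abs_mul _ _
        _ ≤ lam1 * |β p| := mul_le_mul_of_nonneg_right (hp p) (abs_nonneg _)
    have h2 : 0 ≤ β ⬝ᵥ β := Finset.sum_nonneg fun p _ => mul_self_nonneg _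
    rw [h0, fl_expand X hX, ← hz]
    linarith [hd β]
end

section
/- Let X ∈ ℝ^{N×P}, β* ∈ ℝ^P with support S* = {p : β*_p ≠ 0} of cardinality s* ≥ 1, and y = Xβ* + ε for some ε ∈ ℝ^N. Let 0 < λ⁽⁰⁾ < λ, set L = (λ + λ⁽⁰⁾)/(λ − λ⁽⁰⁾), and assume the (L, S*)-compatibility condition holds with constant φ = φ_comp(L, S*) > 0. If ‖Xᵀε‖_∞ ≤ λ⁽⁰⁾, then any minimizer β̂ of the lasso objective ½‖y − Xβ‖₂² + λ‖β‖₁ satisfies: (i) ½‖X(β̂ − β*)‖₂² ≤ 8(λ + λ⁽⁰⁾)² s* / φ², (ii) ‖(β̂ − β*)_{S*}‖₁ ≤ 4(λ + λ⁽⁰⁾) s* / φ², and (iii) ‖β̂_{S̄*}‖₁ ≤ 4 s* (λ + λ⁽⁰⁾)² / [(λ − λ⁽⁰⁾) φ²]. -/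
open Matrix

/-- The lasso objective `f(β) = ½‖y − Xβ‖₂² + λ‖β‖₁`. -/
noncomputable def lassoObj {N P : ℕ} (X : Matrix (Fin N) (Fin P) ℝ) (y : Fin N → ℝ)
    (lam : ℝ) (β : Fin P → ℝ) : ℝ :=
  (1 / 2) * ∑ n, (y n - X.mulVec β n) ^ 2 + lam * ∑ p, |β p|

/-- Oracle inequalities for the lasso under the `(L, S*)`-compatibility
condition, when `‖Xᵀε‖_∞ ≤ λ⁽⁰⁾` with `0 < λ⁽⁰⁾ < λ`: any lasso minimizer `β̂`
satisfies (i) a prediction error bound, (ii) an `ℓ₁` estimation error bound on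
`S*`, and (iii) an `ℓ₁` bound off `S*`. -/
theorem lasso_oracle_inequalities {N P : ℕ} (X : Matrix (Fin N) (Fin P) ℝ)
    (βstar : Fin P → ℝ)
    (Sstar : Finset (Fin P)) (hSstar : Sstar = Finset.univ.filter (fun p => βstar p ≠ 0))
    (sstar : ℕ) (hsstar : sstar = Sstar.card) (hs1 : 1 ≤ sstar)
    (ε : Fin N → ℝ) (y : Fin N → ℝ) (hy : y = X.mulVec βstar + ε)
    (lam0 lam : ℝ) (hlam0 : 0 < lam0) (hlam : lam0 < lam)
    (L : ℝ) (hL : L = (lam + lam0) / (lam - lam0))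
    (φ : ℝ) (hφ : 0 < φ)
    (hcompat : ∀ β : Fin P → ℝ, β ≠ 0 →
      (∑ p ∈ Sstarᶜ, |β p|) ≤ L * ∑ p ∈ Sstar, |β p| →
      φ * ∑ p ∈ Sstar, |β p| ≤
        Real.sqrt (sstar : ℝ) * Real.sqrt (∑ n, (X.mulVec β n) ^ 2))
    (hnoise : (⨆ p : Fin P, |∑ n, X n p * ε n|) ≤ lam0)
    (βhat : Fin P → ℝ)
    (hmin : ∀ β : Fin P → ℝ, lassoObj X y lam βhat ≤ lassoObj X y lam β) :
    (1 / 2) * ∑ n, (X.mulVec (βhat - βstar) n) ^ 2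
        ≤ 8 * (lam + lam0) ^ 2 * sstar / φ ^ 2 ∧
    (∑ p ∈ Sstar, |βhat p - βstar p|) ≤ 4 * (lam + lam0) * sstar / φ ^ 2 ∧
    (∑ p ∈ Sstarᶜ, |βhat p|)
        ≤ 4 * sstar * (lam + lam0) ^ 2 / ((lam - lam0) * φ ^ 2) := by
  have hnz : ∀ p, |∑ n, X n p * ε n| ≤ lam0 := fun p =>
    le_trans (le_ciSup (f := fun p : Fin P => |∑ n, X n p * ε n|)
      (Set.finite_range _).bddAbove p) hnoise
  set d : Fin P → ℝ := βhat - βstar with hd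
  have hdp : ∀ p, d p = βhat p - βstar p := fun p => rfl
  have hoff : ∀ p ∈ Sstarᶜ, βstar p = 0 := by
    intro p hp
    by_contra h
    rw [hSstar] at hp
    simp [h] at hp
  have hB : ∑ p ∈ Sstarᶜ, |d p| = ∑ p ∈ Sstarᶜ, |βhat p| :=
    Finset.sum_congr rfl fun p hp => by rw [hdp, hoff p hp, sub_zero]
  have hA : ∑ p ∈ Sstar, |d p| = ∑ p ∈ Sstar, |βhat p - βstar p| := rfl
  have hinner : ∑ n, ε n * X.mulVec d n ≤ lam0 * ∑ p, |d p| := by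
    have h1 : ∑ n, ε n * X.mulVec d n = ∑ p, (∑ n, X n p * ε n) * d p := by
      simp only [Matrix.mulVec, dotProduct, Finset.mul_sum, Finset.sum_mul]
      rw [Finset.sum_comm]
      exact Finset.sum_congr rfl fun p _ => Finset.sum_congr rfl fun n _ => by ring
    rw [h1, Finset.mul_sum]
    refine Finset.sum_le_sum fun p _ => (le_abs_self _).trans ?_
    rw [abs_mul]
    exact mul_le_mul_of_nonneg_right (hnz p) (abs_nonneg _)
  have hm := hmin βstar
  unfold lassoObj at hm
  have e1 : ∑ n, (y n - X.mulVec βstar n) ^ 2 = ∑ n, ε n ^ 2 :=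
    Finset.sum_congr rfl fun n _ => by rw [hy]; simp
  have e2 : ∑ n, (y n - X.mulVec βhat n) ^ 2
      = ∑ n, ε n ^ 2 - 2 * ∑ n, ε n * X.mulVec d n + ∑ n, (X.mulVec d n) ^ 2 := by
    rw [Finset.mul_sum, ← Finset.sum_sub_distrib, ← Finset.sum_add_distrib]
    refine Finset.sum_congr rfl fun n _ => ?_
    rw [hy, hd, Matrix.mulVec_sub]
    simp only [Pi.add_apply, Pi.sub_apply]
    ring
  have hb : ∑ p, |βstar p| = ∑ p ∈ Sstar, |βstar p| := by
    rw [← Finset.sum_add_sum_compl Sstar,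
      Finset.sum_eq_zero (s := Sstarᶜ) fun p hp => by rw [hoff p hp, abs_zero], add_zero]
  have hbh : ∑ p, |βhat p| = ∑ p ∈ Sstar, |βhat p| + ∑ p ∈ Sstarᶜ, |βhat p| :=
    (Finset.sum_add_sum_compl Sstar _).symm
  have hdd : ∑ p, |d p| = ∑ p ∈ Sstar, |d p| + ∑ p ∈ Sstarᶜ, |d p| :=
    (Finset.sum_add_sum_compl Sstar _).symm
  have htri : ∑ p ∈ Sstar, |βstar p| ≤ ∑ p ∈ Sstar, |βhat p| + ∑ p ∈ Sstar, |d p| := by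
    rw [← Finset.sum_add_distrib]
    refine Finset.sum_le_sum fun p _ => ?_
    have := abs_sub_abs_le_abs_sub (βstar p) (βhat p)
    rw [abs_sub_comm] at this
    rw [hdp]; linarith
  have hQ0 : 0 ≤ ∑ n, (X.mulVec d n) ^ 2 := Finset.sum_nonneg fun _ _ => sq_nonneg _
  have hA0 : 0 ≤ ∑ p ∈ Sstar, |d p| := Finset.sum_nonneg fun _ _ => abs_nonneg _
  have hB0 : 0 ≤ ∑ p ∈ Sstarᶜ, |βhat p| := Finset.sum_nonneg fun _ _ => abs_nonneg _
  have hc := hcompat d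
  rw [hdd, hB] at hinner
  rw [e1, e2, hb, hbh] at hm
  rw [hB] at hc
  rw [← hA]
  have hdz : d = 0 → ∑ p ∈ Sstar, |d p| = 0 := by
    intro h; rw [h]; simp
  clear_value d
  generalize ∑ n, (X.mulVec d n) ^ 2 = Q at *
  generalize ∑ p ∈ Sstar, |d p| = A at *
  generalize ∑ p ∈ Sstarᶜ, |βhat p| = B at *
  have hlt := mul_le_mul_of_nonneg_left htri (hlam0.trans hlam).le
  have hbasic : (1 / 2) * Q + (lam - lam0) * B ≤ (lam + lam0) * A := by linarith
  have hpos : 0 < lam - lam0 := sub_pos.2 hlam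
  have hcone : B ≤ L * A := by
    rw [hL, div_mul_eq_mul_div, le_div_iff₀ hpos]
    linarith
  have hs0 : (0 : ℝ) ≤ sstar := Nat.cast_nonneg _
  have hsq : φ ^ 2 * A ^ 2 ≤ sstar * Q := by
    by_cases h : d = 0
    · rw [hdz h]; simpa using mul_nonneg hs0 hQ0
    · have h2 := pow_le_pow_left₀ (by positivity) (hc h hcone) 2
      rwa [mul_pow, mul_pow, Real.sq_sqrt hs0, Real.sq_sqrt hQ0] at h2
  have hcp : 0 < lam + lam0 := by linarith
  have hBn : 0 ≤ (lam - lam0) * B := mul_nonneg hpos.le hB0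
  have hQA : Q ≤ 2 * ((lam + lam0) * A) := by linarith
  have hAb : A * φ ^ 2 ≤ 2 * (lam + lam0) * sstar := by
    rcases hA0.eq_or_lt with h | h
    · rw [← h, zero_mul]; positivity
    · refine le_of_mul_le_mul_right ?_ h
      have := mul_le_mul_of_nonneg_left hQA hs0
      linarith
  have hcA := mul_le_mul_of_nonneg_left hAb hcp.le
  have hp2 : 0 < φ ^ 2 := by positivity
  have hn : 0 ≤ (lam + lam0) ^ 2 * sstar := by positivity
  have hn' : 0 ≤ (lam + lam0) * sstar := by positivity
  refine ⟨?_, ?_, ?_⟩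
  · rw [le_div_iff₀ hp2]
    have := mul_le_mul_of_nonneg_right hQA hp2.le
    linarith
  · rw [le_div_iff₀ hp2]
    linarith
  · rw [le_div_iff₀ (mul_pos hpos hp2)]
    have : (lam - lam0) * B ≤ (lam + lam0) * A := by linarith
    have := mul_le_mul_of_nonneg_right this hp2.le
    linarith
end

section
/- Let X ∈ ℝ^{N×P}, β* ∈ ℝ^P with support S* = {p : β*_p ≠ 0} of cardinality s* ≥ 1, and y = Xβ* + ε for some ε ∈ ℝ^N. Let 0 < λ⁽⁰⁾ < λ, set L = (λ + λ⁽⁰⁾)/(λ − λ⁽⁰⁾), assume the (L, S*)-compatibility condition holds with constant φ = φ_comp(L, S*) > 0, and assume ‖Xᵀε‖_∞ ≤ λ⁽⁰⁾. If in addition min_{p ∈ S*} |β*_p| > A, where A = 4(λ + λ⁽⁰⁾) s* / φ², then any minimizer β̂ of the lasso objective ½‖y − Xβ‖₂² + λ‖β‖₁ satisfies the screening property: {p : β̂_p ≠ 0} ⊇ S*. -/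
open Matrix

/-- Screening property of the lasso: under the `(L, S*)`-compatibility
condition, `‖Xᵀε‖_∞ ≤ λ⁽⁰⁾` with `0 < λ⁽⁰⁾ < λ`, and the beta-min condition
`min_{p ∈ S*} |β*_p| > A` with `A = 4(λ + λ⁽⁰⁾)s*/φ²`, any lasso minimizer `β̂`
satisfies `{p : β̂_p ≠ 0} ⊇ S*`. -/
theorem lasso_screening {N P : ℕ} (X : Matrix (Fin N) (Fin P) ℝ)
    (βstar : Fin P → ℝ)
    (Sstar : Finset (Fin P)) (hSstar : Sstar = Finset.univ.filter (fun p => βstar p ≠ 0))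
    (sstar : ℕ) (hsstar : sstar = Sstar.card) (hs1 : 1 ≤ sstar)
    (ε : Fin N → ℝ) (y : Fin N → ℝ) (hy : y = X.mulVec βstar + ε)
    (lam0 lam : ℝ) (hlam0 : 0 < lam0) (hlam : lam0 < lam)
    (L : ℝ) (hL : L = (lam + lam0) / (lam - lam0))
    (φ : ℝ) (hφ : 0 < φ)
    (hcompat : ∀ β : Fin P → ℝ, β ≠ 0 →
      (∑ p ∈ Sstarᶜ, |β p|) ≤ L * ∑ p ∈ Sstar, |β p| →
      φ * ∑ p ∈ Sstar, |β p| ≤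
        Real.sqrt (sstar : ℝ) * Real.sqrt (∑ n, (X.mulVec β n) ^ 2))
    (hnoise : (⨆ p : Fin P, |∑ n, X n p * ε n|) ≤ lam0)
    (A : ℝ) (hA : A = 4 * (lam + lam0) * sstar / φ ^ 2)
    (hbetamin : ∀ p ∈ Sstar, A < |βstar p|)
    (βhat : Fin P → ℝ)
    (hmin : ∀ β : Fin P → ℝ, lassoObj X y lam βhat ≤ lassoObj X y lam β) :
    ∀ p ∈ Sstar, βhat p ≠ 0 := by
  intro q hq hq0
  obtain ⟨δ, hδ⟩ : ∃ δ : Fin P → ℝ, δ = βhat - βstar := ⟨_, rfl⟩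
  have hδp : ∀ p, δ p = βhat p - βstar p := fun p => by rw [hδ]; rfl
  have hnoise' : ∀ p, |∑ n, X n p * ε n| ≤ lam0 := fun p =>
    le_trans (le_ciSup (f := fun p : Fin P => |∑ n, X n p * ε n|)
      (Set.finite_range _).bddAbove p) hnoise
  -- cross term
  have hcross : ∑ n, ε n * X.mulVec δ n ≤ lam0 * ∑ p, |δ p| := by
    have h1 : ∑ n, ε n * X.mulVec δ n = ∑ p, (∑ n, X n p * ε n) * δ p := by
      simp only [Matrix.mulVec, dotProduct, Finset.mul_sum, Finset.sum_mul]
      rw [Finset.sum_comm]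
      refine Finset.sum_congr rfl fun p _ => Finset.sum_congr rfl fun n _ => by ring
    rw [h1, Finset.mul_sum]
    refine Finset.sum_le_sum fun p _ => ?_
    refine (le_abs_self _).trans ?_
    rw [abs_mul]
    exact mul_le_mul_of_nonneg_right (hnoise' p) (abs_nonneg _)
  have hb := hmin βstar
  have e1 : ∑ n, (y n - X.mulVec βhat n) ^ 2
      = ∑ n, (ε n) ^ 2 - 2 * ∑ n, ε n * X.mulVec δ n + ∑ n, (X.mulVec δ n) ^ 2 := by
    rw [Finset.mul_sum, ← Finset.sum_sub_distrib, ← Finset.sum_add_distrib]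
    refine Finset.sum_congr rfl fun n _ => ?_
    rw [hδ, Matrix.mulVec_sub, hy]
    simp only [Pi.add_apply, Pi.sub_apply]
    ring
  have e2 : ∑ n, (y n - X.mulVec βstar n) ^ 2 = ∑ n, (ε n) ^ 2 := by
    refine Finset.sum_congr rfl fun n _ => ?_
    rw [hy]
    simp only [Pi.add_apply]
    ring
  unfold lassoObj at hb
  rw [e1, e2] at hb
  have htri : ∑ p, |βstar p| - ∑ p, |βhat p|
      ≤ ∑ p ∈ Sstar, |δ p| - ∑ p ∈ Sstarᶜ, |δ p| := by
    rw [← Finset.sum_add_sum_compl Sstar (fun p => |βstar p|),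
      ← Finset.sum_add_sum_compl Sstar (fun p => |βhat p|)]
    have a1 : ∑ p ∈ Sstar, |βstar p| ≤ ∑ p ∈ Sstar, |δ p| + ∑ p ∈ Sstar, |βhat p| := by
      rw [← Finset.sum_add_distrib]
      refine Finset.sum_le_sum fun p _ => ?_
      rw [hδp, abs_sub_comm]
      have := abs_sub_abs_le_abs_sub (βstar p) (βhat p)
      linarith
    have z : ∀ p ∈ Sstarᶜ, βstar p = 0 := by
      intro p hp
      rw [hSstar] at hp
      simpa using hp
    have a2 : ∑ p ∈ Sstarᶜ, |βstar p| = 0 :=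
      Finset.sum_eq_zero fun p hp => by rw [z p hp, abs_zero]
    have a3 : ∑ p ∈ Sstarᶜ, |δ p| = ∑ p ∈ Sstarᶜ, |βhat p| :=
      Finset.sum_congr rfl fun p hp => by rw [hδp, z p hp, sub_zero]
    linarith
  have hdecomp := Finset.sum_add_sum_compl Sstar (fun p => |δ p|)
  rw [← hdecomp] at hcross
  have hqd : |βstar q| ≤ ∑ p ∈ Sstar, |δ p| := by
    have := Finset.single_le_sum (f := fun p => |δ p|) (fun p _ => abs_nonneg _) hq
    simpa [hδp, hq0] using this
  have hAq := hbetamin q hq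
  have hs : (1 : ℝ) ≤ sstar := by exact_mod_cast hs1
  have hA0 : 0 < A := by
    rw [hA]
    have : 0 < lam := hlam0.trans hlam
    positivity
  have hδ0 : δ ≠ 0 := by
    intro h
    rw [h] at hqd
    simp at hqd
    rw [hqd] at hAq
    simp at hAq
    linarith
  have hc := hcompat δ hδ0
  have hT : 0 ≤ ∑ n, (X.mulVec δ n) ^ 2 := Finset.sum_nonneg fun n _ => sq_nonneg _
  have hE : 0 ≤ ∑ p ∈ Sstarᶜ, |δ p| := Finset.sum_nonneg fun n _ => abs_nonneg _
  generalize (∑ n, (X.mulVec δ n) ^ 2) = T at *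
  generalize (∑ p ∈ Sstarᶜ, |δ p|) = E at *
  generalize (∑ p ∈ Sstar, |δ p|) = D at *
  have hD : A < D := lt_of_lt_of_le hAq hqd
  have hlt := mul_le_mul_of_nonneg_left htri (hlam0.trans hlam).le
  have hmain : 1 / 2 * T + (lam - lam0) * E ≤ (lam + lam0) * D := by linarith
  have hpos : 0 < lam - lam0 := sub_pos.2 hlam
  have hc2 := hc (by
    rw [hL, div_mul_eq_mul_div, le_div_iff₀ hpos]
    linarith)
  rw [← Real.sqrt_mul (by positivity)] at hc2
  have hc3 : (φ * D) ^ 2 ≤ sstar * T := by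
    have h0 : 0 ≤ φ * D := mul_nonneg hφ.le (hA0.trans hD).le
    have := pow_le_pow_left₀ h0 hc2 2
    rwa [Real.sq_sqrt (by positivity)] at this
  have hT2 : T ≤ 2 * ((lam + lam0) * D) := by
    have := mul_nonneg hpos.le hE
    linarith
  have hD0 : 0 < D := hA0.trans hD
  have h5 : (φ ^ 2 * D) * D ≤ (2 * (lam + lam0) * sstar) * D := by
    have := mul_le_mul_of_nonneg_left hT2 (zero_le_one.trans hs)
    linarith
  have h6 := le_of_mul_le_mul_right h5 hD0
  rw [hA, div_lt_iff₀ (by positivity)] at hD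
  have h7 : 0 < (lam + lam0) * sstar := mul_pos (by linarith) (by linarith)
  linarith
end

section
/- Let N ≥ 2, a ∈ ℝ^N with aₙ > 0 for all n, and λ ≥ 0. Consider the total variation density objective over the constraint set C = {φ ∈ ℝ^N : φₙ > 0 for all n, Σ_{n=1}^N aₙφₙ = 1}: f(φ) = −Σ_{n=1}^N log φₙ + λ Σ_{k=1}^{N−1} |φ_{k+1} − φ_k|. Let φ̄ ∈ C be the constant vector with entries 1/(Σ_{n=1}^N aₙ). Then φ̄ is a minimizer of f over C if and only if λ ≥ max_{1 ≤ k ≤ N−1} |w_k|, where w_k = N Σ_{i=1}^k aᵢ − k Σ_{i=1}^N aᵢ. In other words, the zero-thresholding function of total variation density estimation is λ₀ = ‖w‖_∞. -/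
open Matrix

/-- The total variation density objective
`f(φ) = −∑ₙ log φₙ + λ ∑_{k=1}^{N−1} |φ_{k+1} − φ_k|` (here `N = n + 1`). -/
noncomputable def tvDensityObj {n : ℕ} (lam : ℝ) (φ : Fin (n + 1) → ℝ) : ℝ :=
  -∑ i, Real.log (φ i) + lam * ∑ k : Fin n, |φ k.succ - φ k.castSucc|

/-- The constraint set `C = {φ : φₙ > 0 for all n, ∑ₙ aₙφₙ = 1}`. -/
def tvDensityConstraint {n : ℕ} (a : Fin (n + 1) → ℝ) : Set (Fin (n + 1) → ℝ) :=
  {φ | (∀ i, 0 < φ i) ∧ ∑ i, a i * φ i = 1}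

open Filter Topology in
lemma tv_aux_deriv (h : ℝ → ℝ) (w l : ℝ) (hd : HasDerivAt h w 0)
    (hh : ∀ᶠ t in 𝓝 (0:ℝ), h 0 ≤ h t + l * |t|) : |w| ≤ l := by
  have key : ∀ (h : ℝ → ℝ) (w : ℝ), HasDerivAt h w 0 →
      (∀ᶠ t in 𝓝 (0:ℝ), h 0 ≤ h t + l * |t|) → -l ≤ w := by
    intro h w hd hh
    have h1 := (hasDerivAt_iff_tendsto_slope.1 hd).mono_left
      (nhdsWithin_mono (0:ℝ) (fun x (hx : x ∈ Set.Ioi (0:ℝ)) => ne_of_gt hx))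
    refine ge_of_tendsto h1 ?_
    filter_upwards [self_mem_nhdsWithin, nhdsWithin_le_nhds hh] with t ht h2
    have ht : 0 < t := ht
    rw [abs_of_pos ht] at h2
    rw [slope_def_field, sub_zero, le_div_iff₀ ht]
    linarith
  have h1 := key h w hd hh
  have h2 := key (fun t => h (-t)) (-w) (by
    have := HasDerivAt.scomp (0:ℝ) (g₁ := h) (g₁' := w) (by simpa using hd) (hasDerivAt_neg (0:ℝ))
    simpa [Function.comp_def] using this) (by
    have : Tendsto (fun t : ℝ => -t) (𝓝 0) (𝓝 0) := by
      simpa using (continuous_neg (G := ℝ)).tendsto 0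
    filter_upwards [this.eventually hh] with t ht
    simpa using ht)
  rw [abs_le]
  constructor <;> linarith

lemma tv_aux_abel (n : ℕ) (b φ : Fin (n + 1) → ℝ) :
    ∑ i, b i * φ i = (∑ i, b i) * φ (Fin.last n)
      - ∑ k : Fin n, (∑ i ∈ Finset.univ.filter (fun i : Fin (n + 1) => (i : ℕ) ≤ (k : ℕ)), b i)
        * (φ k.succ - φ k.castSucc) := by
  induction n with
  | zero => simp
  | succ n ih =>
    have := ih (fun i => b i.castSucc) (fun i => φ i.castSucc)
    rw [Fin.sum_univ_castSucc, this, Fin.sum_univ_castSucc (f := b),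
      Fin.sum_univ_castSucc (n := n) (f := fun k : Fin (n+1) => (∑ i ∈ Finset.univ.filter (fun i : Fin (n + 1 + 1) => (i : ℕ) ≤ (k : ℕ)), b i)
        * (φ k.succ - φ k.castSucc))]
    have e1 : ∀ k : Fin (n+1), (∑ i ∈ Finset.univ.filter (fun i : Fin (n + 1 + 1) => (i : ℕ) ≤ (k : ℕ)), b i)
       = ∑ i ∈ Finset.univ.filter (fun i : Fin (n + 1) => (i : ℕ) ≤ (k : ℕ)), b i.castSucc := by
      intro k
      rw [Finset.sum_filter, Finset.sum_filter, Fin.sum_univ_castSucc]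
      have := k.2
      rw [if_neg (by simp; omega)]
      simp
    have e2 : (∑ i ∈ Finset.univ.filter (fun i : Fin (n + 1) => (i : ℕ) ≤ ((Fin.last n : Fin (n+1)) : ℕ)), b i.castSucc)
       = ∑ i : Fin (n+1), b i.castSucc := by
      rw [Finset.filter_true_of_mem]
      intro i _
      simp; omega
    simp only [e1]
    rw [e2]
    simp only [Fin.succ_last, Fin.val_castSucc, Fin.succ_castSucc]
    ring

lemma tv_aux_card (n : ℕ) (k : Fin n) :
    (Finset.univ.filter (fun i : Fin (n + 1) => (i : ℕ) ≤ (k : ℕ))).card = (k : ℕ) + 1 := by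
  have : Finset.univ.filter (fun i : Fin (n + 1) => (i : ℕ) ≤ (k : ℕ)) = Finset.Iic k.castSucc := by
    ext i; simp [Fin.le_def]
  rw [this, Fin.card_Iic]; simp

/-- Zero-thresholding for total variation density estimation (here
`N = n + 1 ≥ 2`): the constant vector `φ̄` with entries `1/∑ᵢ aᵢ` minimizes the
objective over `C` iff `λ ≥ max_{1 ≤ k ≤ N−1} |w_k|` with
`w_k = N ∑_{i=1}^k aᵢ − k ∑_{i=1}^N aᵢ`. -/
theorem tv_density_zero_thresholding {n : ℕ} (hn : 1 ≤ n)
    (a : Fin (n + 1) → ℝ) (ha : ∀ i, 0 < a i)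
    (lam : ℝ) (hlam : 0 ≤ lam) :
    ((fun _ => 1 / ∑ i, a i : Fin (n + 1) → ℝ) ∈ tvDensityConstraint a ∧
      ∀ φ ∈ tvDensityConstraint a,
        tvDensityObj lam (fun _ : Fin (n + 1) => 1 / ∑ i, a i) ≤ tvDensityObj lam φ) ↔
      (⨆ k : Fin n,
        |((n : ℝ) + 1) * (∑ i ∈ Finset.univ.filter (fun i : Fin (n + 1) => (i : ℕ) ≤ (k : ℕ)), a i)
          - ((k : ℕ) + 1 : ℝ) * ∑ i, a i|) ≤ lam := by
  have hS : 0 < ∑ i, a i := Finset.sum_pos (fun i _ => ha i) Finset.univ_nonempty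
  have hmem : (fun _ => 1 / ∑ i, a i : Fin (n + 1) → ℝ) ∈ tvDensityConstraint a := by
    refine ⟨fun i => by positivity, ?_⟩
    rw [← Finset.sum_mul]
    field_simp
  have hNe : Nonempty (Fin n) := ⟨⟨0, hn⟩⟩
  set S := ∑ i, a i with hSdef
  have hobj : tvDensityObj lam (fun _ : Fin (n + 1) => 1 / S) = ((n:ℝ)+1) * Real.log S := by
    simp [tvDensityObj]
  rw [hobj]
  constructor
  · rintro ⟨-, hmin⟩
    refine ciSup_le fun k => ?_
    set A := ∑ i ∈ Finset.univ.filter (fun i : Fin (n + 1) => (i : ℕ) ≤ (k : ℕ)), a i with hA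
    let e : Fin (n+1) → ℝ := fun i => (if (i : ℕ) ≤ (k : ℕ) then 1 else 0) - A / S
    have hsd : ∑ i : Fin (n+1), (if (i : ℕ) ≤ (k : ℕ) then (1:ℝ) else 0) = (k:ℕ) + 1 := by
      rw [← Finset.sum_filter, Finset.sum_const, tv_aux_card]; simp
    have hse : ∑ i, e i = ((k:ℕ)+1) - (n+1) * (A / S) := by
      simp only [e]
      rw [Finset.sum_sub_distrib, hsd]; simp
    have hae : ∑ i, a i * e i = 0 := by
      simp only [e, mul_sub]
      rw [Finset.sum_sub_distrib, ← Finset.sum_mul, ← hSdef]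
      simp only [mul_ite, mul_one, mul_zero]
      rw [← Finset.sum_filter, ← hA]
      field_simp
      ring
    refine tv_aux_deriv (fun t => -∑ i, Real.log (1 / S + t * e i)) _ _ ?_ ?_
    · have : HasDerivAt (fun t => -∑ i, Real.log (1 / S + t * e i)) (-∑ i, (e i / (1 / S + 0 * e i))) 0 := by
        refine (HasDerivAt.fun_sum fun i _ => ?_).neg
        refine HasDerivAt.log ?_ (by simp; positivity)
        simpa using ((hasDerivAt_id (0:ℝ)).mul_const (e i)).const_add (1/S)
      convert this using 1
      simp only [zero_mul, add_zero]
      rw [← Finset.sum_div, hse]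
      field_simp
      ring
    · have hpos : ∀ᶠ t in nhds (0:ℝ), ∀ i, 0 < 1 / S + t * e i := by
        rw [Filter.eventually_all]
        intro i
        have hc : ContinuousAt (fun t : ℝ => 1 / S + t * e i) 0 := by fun_prop
        exact hc.eventually (lt_mem_nhds (by simp; positivity))
      filter_upwards [hpos] with t ht
      have h1 := hmin (fun i => 1 / S + t * e i) ⟨ht, by
        have : ∀ i, a i * (1 / S + t * e i) = a i * (1/S) + t * (a i * e i) := fun i => by ring
        simp only [this]
        rw [Finset.sum_add_distrib, ← Finset.mul_sum, hae, ← Finset.sum_mul, ← hSdef]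
        field_simp
        simp⟩
      have htv : ∑ j : Fin n, |(1 / S + t * e j.succ) - (1 / S + t * e j.castSucc)| = |t| := by
        rw [Finset.sum_eq_single k]
        · simp [e]
          rw [show -(t * (A/S)) - t * (1 - A/S) = -t by ring, abs_neg]
        · intro j _ hj
          have hj' : (j:ℕ) ≠ k := fun h => hj (Fin.ext h)
          have : e j.succ = e j.castSucc := by
            simp only [e, Fin.val_succ, Fin.val_castSucc]
            congr 1
            by_cases h : (j:ℕ) + 1 ≤ k
            · rw [if_pos h, if_pos (by omega)]
            · rw [if_neg h, if_neg (by omega)]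
          rw [this]; simp
        · simp
      unfold tvDensityObj at h1
      rw [htv] at h1
      refine le_trans (le_of_eq ?_) h1
      simp
  · intro hsup
    have hw := fun k : Fin n => (le_ciSup (f := fun k : Fin n => |((n : ℝ) + 1) * (∑ i ∈ Finset.univ.filter (fun i : Fin (n + 1) => (i : ℕ) ≤ (k : ℕ)), a i)
          - ((k : ℕ) + 1 : ℝ) * S|) (Set.finite_range _).bddAbove k).trans hsup
    refine ⟨hmem, fun φ hφ => ?_⟩
    obtain ⟨hp, hc⟩ := hφ
    have hlog : ∑ i, Real.log (φ i) ≤ ∑ i, (S * φ i - 1 - Real.log S) := by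
      refine Finset.sum_le_sum fun i _ => ?_
      have := Real.log_le_sub_one_of_pos (mul_pos hS (hp i))
      rw [Real.log_mul hS.ne' (hp i).ne'] at this
      linarith
    have habel := tv_aux_abel n (fun i => (n+1) * a i - S) φ
    have h0 : ∑ i, (((n:ℝ)+1) * a i - S) = 0 := by
      rw [Finset.sum_sub_distrib, ← Finset.mul_sum, ← hSdef]; simp
    have hW : ∀ k : Fin n, ∑ i ∈ Finset.univ.filter (fun i : Fin (n + 1) => (i : ℕ) ≤ (k : ℕ)), (((n:ℝ)+1) * a i - S)
      = ((n : ℝ) + 1) * (∑ i ∈ Finset.univ.filter (fun i : Fin (n + 1) => (i : ℕ) ≤ (k : ℕ)), a i)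
          - ((k : ℕ) + 1 : ℝ) * S := by
      intro k
      rw [Finset.sum_sub_distrib, ← Finset.mul_sum, Finset.sum_const, tv_aux_card]; simp
    rw [h0, zero_mul, zero_sub] at habel
    have hL : ∑ i, (((n:ℝ)+1) * a i - S) * φ i = (n+1) - S * ∑ i, φ i := by
      have : ∀ i, (((n:ℝ)+1) * a i - S) * φ i = (n+1) * (a i * φ i) - S * φ i := fun i => by ring
      simp only [this]
      rw [Finset.sum_sub_distrib, ← Finset.mul_sum, ← Finset.mul_sum, hc, mul_one]
    have hR : ∑ k : Fin n, (∑ i ∈ Finset.univ.filter (fun i : Fin (n + 1) => (i : ℕ) ≤ (k : ℕ)), (((n:ℝ)+1) * a i - S))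
        * (φ k.succ - φ k.castSucc) ≤ lam * ∑ k : Fin n, |φ k.succ - φ k.castSucc| := by
      rw [Finset.mul_sum]
      refine Finset.sum_le_sum fun k _ => ?_
      rw [hW]
      refine (le_abs_self _).trans ?_
      rw [abs_mul]
      exact mul_le_mul_of_nonneg_right (hw k) (abs_nonneg _)
    have hs : ∑ i, (S * φ i - 1 - Real.log S) = S * ∑ i, φ i - (n+1) - (n+1) * Real.log S := by
      rw [Finset.sum_sub_distrib, Finset.sum_sub_distrib, ← Finset.mul_sum]; simp
    unfold tvDensityObj
    linarith
end
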